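/- arXiv:2102.00049 — 4 statements merged into one kernel-verified Lean document; each statement's English description precedes it below -/
import Mathlib

section
/- There exists a uniform constant C₀ > 0 (one may take C₀ = 50) such that for every increasing homeomorphism h : ℝ → ℝ and all x ∈ ℝ, y > 0, the quasiconformal dilatation K_h of the Beurling–Ahlfors extension satisfies ρ_h(x,y)/4 ≤ K_h(x,y) ≤ C₀ · max{ ρ_h(x,y), (2/y) ∫_{−y/4}^{y/4} ρ_h(x+z, y−|z|) dz }. -/
open MeasureTheory Set Function

noncomputable section

/-- The symmetric distortion function of an increasing homeomorphism `h : ℝ → ℝ`. -/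
def rhoDist (h : ℝ → ℝ) (x t : ℝ) : ℝ :=
  max ((h (x + t) - h x) / (h x - h (x - t)))
      ((h x - h (x - t)) / (h (x + t) - h x))

/-- `u_x` partial derivative of the Beurling–Ahlfors extension. -/
def BAux (h : ℝ → ℝ) (x y : ℝ) : ℝ := (h (x + y) - h (x - y)) / (2 * y)

/-- `u_y` partial derivative of the Beurling–Ahlfors extension. -/
def BAuy (h : ℝ → ℝ) (x y : ℝ) : ℝ :=
  (h (x + y) + h (x - y) - (1 / y) * (∫ t in x..(x + y), h t)
    - (1 / y) * (∫ t in (x - y)..x, h t)) / (2 * y)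

/-- `v_x` partial derivative of the Beurling–Ahlfors extension. -/
def BAvx (h : ℝ → ℝ) (x y : ℝ) : ℝ := (h (x + y) + h (x - y) - 2 * h x) / (2 * y)

/-- `v_y` partial derivative of the Beurling–Ahlfors extension. -/
def BAvy (h : ℝ → ℝ) (x y : ℝ) : ℝ :=
  (h (x + y) - h (x - y) - (1 / y) * (∫ t in x..(x + y), h t)
    + (1 / y) * (∫ t in (x - y)..x, h t)) / (2 * y)

/-- The quantity `(u_x² + u_y² + v_x² + v_y²)/(u_x v_y − u_y v_x)`, which equals
`K + 1/K` for the quasiconformal dilatation `K` of the Beurling–Ahlfors extension. -/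
def BAdil (h : ℝ → ℝ) (x y : ℝ) : ℝ :=
  ((BAux h x y) ^ 2 + (BAuy h x y) ^ 2 + (BAvx h x y) ^ 2 + (BAvy h x y) ^ 2) /
    (BAux h x y * BAvy h x y - BAuy h x y * BAvx h x y)

/-- Average of `h (x + y) - h` over `[x, x + y]`. -/
def upperGap (h : ℝ → ℝ) (x y : ℝ) : ℝ := h (x + y) - (1 / y) * ∫ t in x..(x + y), h t

/-- Average of `h - h (x - y)` over `[x - y, x]`. -/
def lowerGap (h : ℝ → ℝ) (x y : ℝ) : ℝ := (1 / y) * (∫ t in (x - y)..x, h t) - h (x - y)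

/-- The conjugate of `h` by `t ↦ -t`. -/
def negConj (h : ℝ → ℝ) (t : ℝ) : ℝ := -h (-t)

theorem BAdil_eq (h : ℝ → ℝ) (x : ℝ) {y : ℝ} (hy : 0 < y) :
    BAdil h x y =
      ((h (x + y) - h x) ^ 2 + (h x - h (x - y)) ^ 2 + upperGap h x y ^ 2 + lowerGap h x y ^ 2) /
        ((h (x + y) - h x) * lowerGap h x y + (h x - h (x - y)) * upperGap h x y) := by
  have e : (1 : ℝ) / (2 * y ^ 2) ≠ 0 := by positivity
  rw [← mul_div_mul_left _ _ e]
  unfold BAdil BAux BAuy BAvx BAvy upperGap lowerGap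
  congr 1 <;> field_simp <;> ring

theorem upperGap_negConj (h : ℝ → ℝ) (x y : ℝ) :
    upperGap (negConj h) (-x) y = lowerGap h x y := by
  have e : (∫ t in (-x)..(-x + y), h (-t)) = ∫ t in (x - y)..x, h t := by
    rw [intervalIntegral.integral_comp_neg]
    congr 1 <;> ring
  simp only [upperGap, lowerGap, negConj, intervalIntegral.integral_neg, e]
  rw [show -(-x + y) = x - y by ring]
  ring

theorem lowerGap_negConj (h : ℝ → ℝ) (x y : ℝ) :
    lowerGap (negConj h) (-x) y = upperGap h x y := by
  have e : (∫ t in (-x - y)..(-x), h (-t)) = ∫ t in x..(x + y), h t := by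
    rw [intervalIntegral.integral_comp_neg]
    congr 1 <;> ring
  simp only [upperGap, lowerGap, negConj, intervalIntegral.integral_neg, e]
  rw [show -(-x - y) = x + y by ring]
  ring

theorem rhoDist_negConj (h : ℝ → ℝ) (x t : ℝ) :
    rhoDist (negConj h) (-x) t = rhoDist h x t := by
  unfold rhoDist negConj
  rw [max_comm, show -(-x + t) = x - t by ring, show -(-x - t) = x + t by ring, neg_neg]
  congr 2 <;> ring

theorem BAdil_negConj (h : ℝ → ℝ) (x : ℝ) {y : ℝ} (hy : 0 < y) :
    BAdil (negConj h) (-x) y = BAdil h x y := by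
  rw [BAdil_eq _ _ hy, BAdil_eq _ _ hy, upperGap_negConj, lowerGap_negConj]
  simp only [negConj]
  rw [show -(-x + y) = x - y by ring, show -(-x - y) = x + y by ring, neg_neg]
  congr 1 <;> ring

theorem integral_rhoDist_negConj (h : ℝ → ℝ) (x y : ℝ) :
    (∫ z in (-(y / 4))..(y / 4), rhoDist (negConj h) (-x + z) (y - |z|)) =
      ∫ z in (-(y / 4))..(y / 4), rhoDist h (x + z) (y - |z|) := by
  have e : ∀ z, rhoDist (negConj h) (-x + z) (y - |z|) = rhoDist h (x + -z) (y - |-z|) := by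
    intro z
    rw [← rhoDist_negConj h (x + -z), abs_neg]
    congr 1
    ring
  simp only [e]
  rw [intervalIntegral.integral_comp_neg fun z => rhoDist h (x + z) (y - |z|), neg_neg]

theorem rhoDist_nonneg {h : ℝ → ℝ} (hm : StrictMono h) (x : ℝ) {t : ℝ} (ht : 0 ≤ t) :
    0 ≤ rhoDist h x t := by
  have h1 := hm.monotone (show x ≤ x + t by linarith)
  have h2 := hm.monotone (show x - t ≤ x by linarith)
  exact le_max_of_le_left (div_nonneg (by linarith) (by linarith))

theorem mul_sub_le_integral {h : ℝ → ℝ} (hm : StrictMono h) (hc : Continuous h)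
    {a b : ℝ} (hab : a ≤ b) : (b - a) * h a ≤ ∫ t in a..b, h t := by
  have := intervalIntegral.integral_mono_on (μ := volume) hab intervalIntegrable_const
    (hc.intervalIntegrable a b) fun t ht => hm.monotone ht.1
  simpa using this

theorem integral_le_mul_sub {h : ℝ → ℝ} (hm : StrictMono h) (hc : Continuous h)
    {a b : ℝ} (hab : a ≤ b) : ∫ t in a..b, h t ≤ (b - a) * h b := by
  have := intervalIntegral.integral_mono_on (μ := volume) hab (hc.intervalIntegrable a b)
    intervalIntegrable_const fun t ht => hm.monotone ht.2
  simpa using this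

theorem half_increment_le_upperGap {h : ℝ → ℝ} (hm : StrictMono h) (hc : Continuous h)
    (x : ℝ) {y : ℝ} (hy : 0 < y) :
    h (x + y) - h (x + y / 2) ≤ 2 * upperGap h x y := by
  have h1 := integral_le_mul_sub hm hc (show x ≤ x + y / 2 by linarith)
  have h2 := integral_le_mul_sub hm hc (show x + y / 2 ≤ x + y by linarith)
  have h3 := intervalIntegral.integral_add_adjacent_intervals (μ := volume)
    (hc.intervalIntegrable x (x + y / 2)) (hc.intervalIntegrable (x + y / 2) (x + y))
  have h4 : (1 / y) * (∫ t in x..(x + y), h t) ≤ (h (x + y / 2) + h (x + y)) / 2 := by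
    rw [one_div, inv_mul_le_iff₀ hy]
    nlinarith
  unfold upperGap
  linarith

theorem upperGap_pos {h : ℝ → ℝ} (hm : StrictMono h) (hc : Continuous h)
    (x : ℝ) {y : ℝ} (hy : 0 < y) : 0 < upperGap h x y := by
  have h1 := half_increment_le_upperGap hm hc x hy
  have h2 := hm (show x + y / 2 < x + y by linarith)
  linarith

theorem upperGap_le {h : ℝ → ℝ} (hm : StrictMono h) (hc : Continuous h)
    (x : ℝ) {y : ℝ} (hy : 0 < y) : upperGap h x y ≤ h (x + y) - h x := by
  have h1 := mul_sub_le_integral hm hc (show x ≤ x + y by linarith)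
  have h2 : h x ≤ (1 / y) * ∫ t in x..(x + y), h t := by
    rw [one_div, le_inv_mul_iff₀ hy]
    linarith
  unfold upperGap
  linarith

theorem strictMono_negConj {h : ℝ → ℝ} (hm : StrictMono h) : StrictMono (negConj h) :=
  fun _ _ hab => neg_lt_neg (hm (neg_lt_neg hab))

theorem continuous_negConj {h : ℝ → ℝ} (hc : Continuous h) : Continuous (negConj h) :=
  (hc.comp continuous_neg).neg

theorem lowerGap_pos {h : ℝ → ℝ} (hm : StrictMono h) (hc : Continuous h)
    (x : ℝ) {y : ℝ} (hy : 0 < y) : 0 < lowerGap h x y := by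
  rw [← upperGap_negConj]
  exact upperGap_pos (strictMono_negConj hm) (continuous_negConj hc) _ hy

theorem lowerGap_le {h : ℝ → ℝ} (hm : StrictMono h) (hc : Continuous h)
    (x : ℝ) {y : ℝ} (hy : 0 < y) : lowerGap h x y ≤ h x - h (x - y) := by
  have := upperGap_le (strictMono_negConj hm) (continuous_negConj hc) (-x) hy
  rw [upperGap_negConj] at this
  simp only [negConj] at this
  rw [show -(-x + y) = x - y by ring, neg_neg] at this
  linarith

theorem rhoDist_div_two_le_BAdil {h : ℝ → ℝ} (hm : StrictMono h) (hc : Continuous h)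
    (x : ℝ) {y : ℝ} (hy : 0 < y) :
    rhoDist h x y / 2 ≤ BAdil h x y := by
  have hα : 0 < h (x + y) - h x := sub_pos.2 (hm (by linarith))
  have hβ : 0 < h x - h (x - y) := sub_pos.2 (hm (by linarith))
  have hA := upperGap_pos hm hc x hy
  have hB := lowerGap_pos hm hc x hy
  have hA' := upperGap_le hm hc x hy
  have hB' := lowerGap_le hm hc x hy
  rw [BAdil_eq _ _ hy]
  unfold rhoDist
  set α := h (x + y) - h x
  set β := h x - h (x - y)
  set A := upperGap h x y
  set B := lowerGap h x y
  have hD : α * B + β * A ≤ 2 * (α * β) := by nlinarith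
  have hle : (α ^ 2 + β ^ 2) / (2 * (α * β)) ≤
      (α ^ 2 + β ^ 2 + A ^ 2 + B ^ 2) / (α * B + β * A) := by
    apply div_le_div₀ (by positivity) (by linarith [sq_nonneg A, sq_nonneg B]) (by positivity) hD
  have e : (α ^ 2 + β ^ 2) / (2 * (α * β)) = (α / β + β / α) / 2 := by field_simp
  rw [e] at hle
  refine le_trans ?_ hle
  gcongr
  apply max_le <;> simp only [le_add_iff_nonneg_right, le_add_iff_nonneg_left] <;> positivity

theorem continuousOn_rhoDist {h : ℝ → ℝ} (hm : StrictMono h) (hc : Continuous h)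
    (x : ℝ) {y : ℝ} (hy : 0 < y) :
    ContinuousOn (fun z => rhoDist h (x + z) (y - |z|)) (Icc (-(y / 4)) (y / 4)) := by
  have hpos : ∀ z ∈ Icc (-(y / 4)) (y / 4), 0 < y - |z| := by
    intro z hz
    have := abs_le.2 hz
    linarith
  unfold rhoDist
  refine ContinuousOn.sup (ContinuousOn.div ?_ ?_ ?_) (ContinuousOn.div ?_ ?_ ?_)
  · fun_prop
  · fun_prop
  · intro z hz
    exact (sub_pos.2 (hm (by linarith [hpos z hz]))).ne'
  · fun_prop
  · fun_prop
  · intro z hz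
    exact (sub_pos.2 (hm (by linarith [hpos z hz]))).ne'

/-- The tangent-line form of Jensen's inequality, `1 / g ≥ 2 / m - g / m ^ 2`, is applied with
`m` equal to four times the lower gap. -/
theorem div_lowerGap_le_integral_rhoDist {h : ℝ → ℝ} (hm : StrictMono h) (hc : Continuous h)
    (x : ℝ) {y : ℝ} (hy : 0 < y) :
    (h (x + y / 2) - h x) / (8 * lowerGap h x y) ≤
      (2 / y) * ∫ z in (-(y / 4))..(y / 4), rhoDist h (x + z) (y - |z|) := by
  have hB := lowerGap_pos hm hc x hy
  have hBdef : y * lowerGap h x y = (∫ t in (x - y)..x, h t) - y * h (x - y) := by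
    unfold lowerGap
    field_simp
  set B := lowerGap h x y
  set c := h (x + y / 2) - h x
  have hcpos : 0 < c := sub_pos.2 (hm (by linarith))
  have hcont := continuousOn_rhoDist hm hc x hy
  have hint : ∀ a b, a ∈ Icc (-(y / 4)) (y / 4) → b ∈ Icc (-(y / 4)) (y / 4) →
      IntervalIntegrable (fun z => rhoDist h (x + z) (y - |z|)) volume a b := fun a b ha hb =>
    (hcont.mono (uIcc_subset_Icc ha hb)).intervalIntegrable
  have m1 : -(y / 4) ∈ Icc (-(y / 4)) (y / 4) := ⟨le_rfl, by linarith⟩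
  have m2 : (0 : ℝ) ∈ Icc (-(y / 4)) (y / 4) := ⟨by linarith, by linarith⟩
  have m3 : y / 4 ∈ Icc (-(y / 4)) (y / 4) := ⟨by linarith, le_rfl⟩
  rw [← intervalIntegral.integral_add_adjacent_intervals (hint _ _ m1 m2) (hint _ _ m2 m3)]
  have hright : 0 ≤ ∫ z in (0 : ℝ)..(y / 4), rhoDist h (x + z) (y - |z|) := by
    refine intervalIntegral.integral_nonneg (by linarith) fun z hz => rhoDist_nonneg hm _ ?_
    rw [abs_of_nonneg hz.1]
    linarith [hz.2]
  have hpt : ∀ z ∈ Icc (-(y / 4)) 0,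
      c * (2 / (4 * B) - (h (x + z) - h (x - y)) / (4 * B) ^ 2) ≤
        rhoDist h (x + z) (y - |z|) := by
    intro z hz
    have hg : 0 < h (x + z) - h (x - y) := sub_pos.2 (hm (by linarith [hz.1]))
    have hnum : c ≤ h (x + z + (y - |z|)) - h (x + z) := by
      rw [abs_of_nonpos hz.2]
      have n1 := hm.monotone (show x + y / 2 ≤ x + z + (y - -z) by linarith [hz.1])
      have n2 := hm.monotone (show x + z ≤ x by linarith [hz.2])
      linarith
    have hden : x + z - (y - |z|) = x - y := by
      rw [abs_of_nonpos hz.2]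
      ring
    unfold rhoDist
    rw [hden]
    refine le_max_of_le_left (le_trans ?_ (div_le_div_of_nonneg_right hnum hg.le))
    rw [div_eq_mul_inv c]
    gcongr
    set g := h (x + z) - h (x - y)
    have : g⁻¹ - (2 / (4 * B) - g / (4 * B) ^ 2) = (g - 4 * B) ^ 2 / (g * (4 * B) ^ 2) := by
      field_simp
      ring
    have : 0 ≤ (g - 4 * B) ^ 2 / (g * (4 * B) ^ 2) := by positivity
    linarith
  have hleft := intervalIntegral.integral_mono_on (μ := volume) (by linarith)
    (Continuous.intervalIntegrable (by fun_prop) _ _) (hint _ _ m1 m2) hpt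
  have hval : (∫ z in (-(y / 4))..0,
      c * (2 / (4 * B) - (h (x + z) - h (x - y)) / (4 * B) ^ 2)) =
      c * (y / 4 * (2 / (4 * B)) -
        ((∫ t in (x - y / 4)..x, h t) - y / 4 * h (x - y)) / (4 * B) ^ 2) := by
    have hi : IntervalIntegrable (fun z => h (x + z)) volume (-(y / 4)) 0 :=
      Continuous.intervalIntegrable (by fun_prop) _ _
    rw [intervalIntegral.integral_const_mul, intervalIntegral.integral_sub
      (f := fun _ => 2 / (4 * B)) intervalIntegrable_const
      ((hi.sub intervalIntegrable_const).div_const _),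
      intervalIntegral.integral_div _ fun z => h (x + z) - h (x - y),
      intervalIntegral.integral_sub hi intervalIntegrable_const,
      intervalIntegral.integral_comp_add_left]
    simp [sub_eq_add_neg, mul_div_assoc]
  have hQ : (∫ t in (x - y / 4)..x, h t) - y / 4 * h (x - y) ≤ y * B := by
    have q1 := mul_sub_le_integral hm hc (show x - y ≤ x - y / 4 by linarith)
    have q2 := intervalIntegral.integral_add_adjacent_intervals (μ := volume)
      (hc.intervalIntegrable (x - y) (x - y / 4)) (hc.intervalIntegrable (x - y / 4) x)
    linarith
  have hlow : c * (y / 4 * (2 / (4 * B)) - y * B / (4 * B) ^ 2) ≤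
      ∫ z in (-(y / 4))..0, rhoDist h (x + z) (y - |z|) := by
    refine le_trans ?_ (hval ▸ hleft)
    gcongr
  calc c / (8 * B) = (2 / y) * (c * (y / 4 * (2 / (4 * B)) - y * B / (4 * B) ^ 2)) := by
        field_simp
        ring
    _ ≤ _ := by
        gcongr
        linarith

theorem BAdil_le_of_le {h : ℝ → ℝ} (hm : StrictMono h) (hc : Continuous h)
    (x : ℝ) {y : ℝ} (hy : 0 < y)
    (hβα : h x - h (x - y) ≤ h (x + y) - h x) :
    BAdil h x y ≤ 64 * max (rhoDist h x y)
      ((2 / y) * ∫ z in (-(y / 4))..(y / 4), rhoDist h (x + z) (y - |z|)) := by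
  have hα : 0 < h (x + y) - h x := sub_pos.2 (hm (by linarith))
  have hβ : 0 < h x - h (x - y) := sub_pos.2 (hm (by linarith))
  have hA := upperGap_pos hm hc x hy
  have hB := lowerGap_pos hm hc x hy
  have hA' := upperGap_le hm hc x hy
  have hB' := lowerGap_le hm hc x hy
  have hI := div_lowerGap_le_integral_rhoDist hm hc x hy
  have hhalf := half_increment_le_upperGap hm hc x hy
  have hρ : (h (x + y) - h x) / (h x - h (x - y)) ≤ rhoDist h x y := le_max_left _ _
  rw [BAdil_eq _ _ hy]
  set α := h (x + y) - h x
  set β := h x - h (x - y)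
  set A := upperGap h x y
  set B := lowerGap h x y
  have hnum : α ^ 2 + β ^ 2 + A ^ 2 + B ^ 2 ≤ 4 * α ^ 2 := by nlinarith
  rcases le_total A (α / 4) with hcase | hcase
  · have hI' : α / (16 * B) ≤ (h (x + y / 2) - h x) / (8 * B) := by
      rw [div_le_div_iff₀ (by positivity) (by positivity)]
      nlinarith
    calc _ ≤ 4 * α ^ 2 / (α * B) := by
          gcongr
          linarith [mul_pos hβ hA]
      _ = 64 * (α / (16 * B)) := by
          field_simp
          ring
      _ ≤ _ := by
          gcongr
          exact le_max_of_le_right (hI'.trans hI)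
  · have hratio : 0 ≤ α / β := by positivity
    calc _ ≤ 4 * α ^ 2 / (β * (α / 4)) := by
          gcongr
          linarith [mul_pos hα hB, mul_le_mul_of_nonneg_left hcase hβ.le]
      _ = 16 * (α / β) := by
          field_simp
          ring
      _ ≤ 64 * (α / β) := by linarith
      _ ≤ _ := by
          gcongr
          exact le_max_of_le_left hρ

theorem BAdil_le {h : ℝ → ℝ} (hm : StrictMono h) (hc : Continuous h) (x : ℝ) {y : ℝ} (hy : 0 < y) :
    BAdil h x y ≤ 64 * max (rhoDist h x y)
      ((2 / y) * ∫ z in (-(y / 4))..(y / 4), rhoDist h (x + z) (y - |z|)) := by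
  rcases le_total (h x - h (x - y)) (h (x + y) - h x) with hle | hle
  · exact BAdil_le_of_le hm hc x hy hle
  · rw [← BAdil_negConj h x hy, ← rhoDist_negConj, ← integral_rhoDist_negConj]
    refine BAdil_le_of_le (strictMono_negConj hm) (continuous_negConj hc) _ hy ?_
    simp only [negConj]
    rw [show -(-x + y) = x - y by ring, show -(-x - y) = x + y by ring, neg_neg]
    linarith

/-- There is a uniform constant `C₀ > 0` such that for every increasing
homeomorphism `h` of the real line, the quasiconformal dilatation `K` of its
Beurling–Ahlfors extension (the unique `K ≥ 1` with `K + 1/K = BAdil h`) satisfies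
`ρ_h(x,y)/4 ≤ K(x,y) ≤ C₀ · max {ρ_h(x,y), (2/y) ∫_{-y/4}^{y/4} ρ_h(x+z, y−|z|) dz}`. -/
theorem beurling_ahlfors_dilatation_bounds :
    ∃ C₀ : ℝ, 0 < C₀ ∧
      ∀ (h : ℝ → ℝ), StrictMono h → Surjective h →
      ∀ (K : ℝ → ℝ → ℝ),
        (∀ x y : ℝ, 0 < y → 1 ≤ K x y ∧ K x y + (K x y)⁻¹ = BAdil h x y) →
      ∀ x y : ℝ, 0 < y →
        rhoDist h x y / 4 ≤ K x y ∧
        K x y ≤ C₀ * max (rhoDist h x y)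
          ((2 / y) * ∫ z in (-(y / 4))..(y / 4), rhoDist h (x + z) (y - |z|)) := by
  refine ⟨64, by norm_num, fun h hm hs K hK x y hy => ?_⟩
  have hc : Continuous h := hm.monotone.continuous_of_surjective hs
  obtain ⟨hK1, hK2⟩ := hK x y hy
  have hinv : (K x y)⁻¹ ≤ 1 := inv_le_one_of_one_le₀ hK1
  have hinv0 : 0 < (K x y)⁻¹ := by positivity
  have hlow := rhoDist_div_two_le_BAdil hm hc x hy
  have hup := BAdil_le hm hc x hy
  exact ⟨by linarith, by linarith⟩
end
end

section
/- There exist uniform constants C₀ > 0 (the constant of the main dilatation bound) and C > 0 such that for every increasing convex function Φ : [0,∞) → [0,∞), every increasing homeomorphism h : ℝ → ℝ, and every q > 0, one has ∫_ℍ Φ(q·(4C₀)⁻¹·ρ_h) dσ ≤ ∫_ℍ Φ(q·C₀⁻¹·K_h) dσ ≤ C ∫_ℍ Φ(q·ρ_h) dσ. -/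
open MeasureTheory Set Function

noncomputable section

/-- The open upper half-plane, as a subset of `ℝ × ℝ`. -/
def upperHP : Set (ℝ × ℝ) := {p | 0 < p.2}

/-- The density of the spherical measure `dσ = 4 dx dy/(1 + x² + y²)²`. -/
def sphDen (p : ℝ × ℝ) : ℝ := 4 / (1 + p.1 ^ 2 + p.2 ^ 2) ^ 2

/-- Upper and lower bounds for the integral of a monotone function, the upper one obtained by
splitting the interval of integration at `c`. -/
lemma intervalIntegral_bounds_of_monotone {h : ℝ → ℝ} (hm : Monotone h) {a c b : ℝ}
    (hac : a ≤ c) (hcb : c ≤ b) :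
    (c - a) * h a + (b - c) * h c ≤ ∫ t in a..b, h t ∧
      ∫ t in a..b, h t ≤ (c - a) * h c + (b - c) * h b := by
  have hi : ∀ u v : ℝ, IntervalIntegrable h volume u v := fun u v => hm.intervalIntegrable
  have lower : ∀ u v : ℝ, u ≤ v → (v - u) * h u ≤ ∫ t in u..v, h t := fun u v huv => by
    have := intervalIntegral.integral_mono_on huv (by simp) (hi u v)
      (fun t (ht : t ∈ Icc u v) => hm ht.1)
    simpa using this
  have upper : ∀ u v : ℝ, u ≤ v → ∫ t in u..v, h t ≤ (v - u) * h v := fun u v huv => by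
    have := intervalIntegral.integral_mono_on huv (hi u v) (by simp)
      (fun t (ht : t ∈ Icc u v) => hm ht.2)
    simpa using this
  rw [← intervalIntegral.integral_add_adjacent_intervals (hi a c) (hi c b)]
  exact ⟨add_le_add (lower a c hac) (lower c b hcb), add_le_add (upper a c hac) (upper c b hcb)⟩

/-- The Beurling–Ahlfors dilatation in terms of the increments of `h` and of the deviations `p`, `q`
of `h (x + y)` and `h (x - y)` from the adjacent averages. -/
lemma exists_BAdil_eq {h : ℝ → ℝ} (hm : StrictMono h) (x : ℝ) {y : ℝ} (hy : 0 < y) :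
    ∃ p q : ℝ, p ≤ h (x + y) - h x ∧ q ≤ h x - h (x - y) ∧
      h (x + y) - h (x + y / 4) ≤ 4 * p ∧ h (x - y / 4) - h (x - y) ≤ 4 * q ∧
      BAdil h x y = ((h (x + y) - h x) ^ 2 + (h x - h (x - y)) ^ 2 + p ^ 2 + q ^ 2) /
        ((h (x + y) - h x) * q + (h x - h (x - y)) * p) := by
  obtain ⟨-, hR⟩ := intervalIntegral_bounds_of_monotone hm.monotone
    (show x ≤ x + y / 4 by linarith) (show x + y / 4 ≤ x + y by linarith)
  obtain ⟨hR', -⟩ := intervalIntegral_bounds_of_monotone hm.monotone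
    (show x ≤ x by linarith) (show x ≤ x + y by linarith)
  obtain ⟨hL, -⟩ := intervalIntegral_bounds_of_monotone hm.monotone
    (show x - y ≤ x - y / 4 by linarith) (show x - y / 4 ≤ x by linarith)
  obtain ⟨-, hL'⟩ := intervalIntegral_bounds_of_monotone hm.monotone
    (show x - y ≤ x by linarith) (show x ≤ x by linarith)
  have hdil : BAdil h x y = ((h (x + y) - h x) ^ 2 + (h x - h (x - y)) ^ 2
        + (h (x + y) - (1 / y) * ∫ t in x..(x + y), h t) ^ 2
        + ((1 / y) * (∫ t in (x - y)..x, h t) - h (x - y)) ^ 2) /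
      ((h (x + y) - h x) * ((1 / y) * (∫ t in (x - y)..x, h t) - h (x - y))
        + (h x - h (x - y)) * (h (x + y) - (1 / y) * ∫ t in x..(x + y), h t)) := by
    unfold BAdil BAux BAuy BAvx BAvy
    set I := (1 / y) * ∫ t in x..(x + y), h t
    set J := (1 / y) * ∫ t in (x - y)..x, h t
    have h2 : (2 * y ^ 2 : ℝ) ≠ 0 := by positivity
    rw [← mul_div_mul_left _ _ h2]
    congr 1 <;> field_simp <;> ring
  have hI : y * ((1 / y) * ∫ t in x..(x + y), h t) = ∫ t in x..(x + y), h t := by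
    field_simp
  have hJ : y * ((1 / y) * ∫ t in (x - y)..x, h t) = ∫ t in (x - y)..x, h t := by
    field_simp
  rw [← hI] at hR hR'
  rw [← hJ] at hL hL'
  refine ⟨_, _, ?_, ?_, ?_, ?_, hdil⟩ <;> refine le_of_mul_le_mul_left ?_ hy <;> linarith

lemma le_four_mul_of_add_inv_eq {a b p q K : ℝ} (hb : 0 < b) (hp : 0 < p) (hq : 0 < q)
    (hpa : p ≤ a) (hqb : q ≤ b) (hK : 1 ≤ K)
    (h : K + K⁻¹ = (a ^ 2 + b ^ 2 + p ^ 2 + q ^ 2) / (a * q + b * p)) : a / b ≤ 4 * K := by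
  have ha : 0 < a := hp.trans_le hpa
  have hinv : K⁻¹ ≤ K := (inv_le_one_of_one_le₀ hK).trans hK
  have : a / (2 * b) ≤ K + K⁻¹ := by
    rw [h, div_le_div_iff₀ (by positivity) (by positivity)]
    nlinarith [mul_le_mul_of_nonneg_left hqb (sq_nonneg a),
      mul_le_mul_of_nonneg_left hpa (mul_nonneg ha.le hb.le),
      mul_nonneg hb.le (add_nonneg (add_nonneg (sq_nonneg b) (sq_nonneg p)) (sq_nonneg q))]
  have e : a / b = 2 * (a / (2 * b)) := by field_simp
  linarith

lemma le_of_add_inv_eq {a b p q K m : ℝ} (hb : 0 < b) (hp : 0 < p) (hq : 0 < q)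
    (hpa : p ≤ a) (hqb : q ≤ b) (hab : b ≤ a) (hK : 1 ≤ K)
    (h : K + K⁻¹ = (a ^ 2 + b ^ 2 + p ^ 2 + q ^ 2) / (a * q + b * p))
    (hm₁ : a / b ≤ m) (hm₂ : p ≤ a / 8 → a / (8 * q) ≤ m) : K ≤ 32 * m := by
  have ha : 0 < a := hp.trans_le hpa
  have hK' : K ≤ K + K⁻¹ := le_add_of_nonneg_right (by positivity)
  have hnum : a ^ 2 + b ^ 2 + p ^ 2 + q ^ 2 ≤ 4 * a ^ 2 := by nlinarith
  have hqa : 0 < a * q := by positivity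
  have hpb : 0 < b * p := by positivity
  rw [h] at hK'
  rcases le_total p (a / 8) with hp8 | hp8
  · calc K ≤ 4 * a ^ 2 / (a * q) := hK'.trans (by gcongr; linarith)
      _ = 32 * (a / (8 * q)) := by field_simp; norm_num
      _ ≤ 32 * m := by linarith [hm₂ hp8]
  · calc K ≤ 4 * a ^ 2 / (b * (a / 8)) := hK'.trans (by gcongr; nlinarith)
      _ = 32 * (a / b) := by field_simp; norm_num
      _ ≤ 32 * m := by linarith

lemma rhoDist_pos {h : ℝ → ℝ} (hm : StrictMono h) (x : ℝ) {y : ℝ} (hy : 0 < y) :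
    0 < rhoDist h x y :=
  lt_max_of_lt_left <| div_pos (sub_pos.2 <| hm <| by linarith) (sub_pos.2 <| hm <| by linarith)

lemma rhoDist_le_four_mul {h : ℝ → ℝ} (hm : StrictMono h) {x y K : ℝ} (hy : 0 < y)
    (hK : 1 ≤ K) (hKd : K + K⁻¹ = BAdil h x y) : rhoDist h x y ≤ 4 * K := by
  obtain ⟨p, q, hpa, hqb, hp, hq, e⟩ := exists_BAdil_eq hm x hy
  have h1 : h (x + y / 4) < h (x + y) := hm (by linarith)
  have h2 : h (x - y) < h (x - y / 4) := hm (by linarith)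
  have h3 : h x < h (x + y) := hm (by linarith)
  have h4 : h (x - y) < h x := hm (by linarith)
  rw [e] at hKd
  refine max_le ?_ ?_
  · exact le_four_mul_of_add_inv_eq (by linarith) (by linarith) (by linarith) hpa hqb hK hKd
  · refine le_four_mul_of_add_inv_eq (p := q) (q := p) (by linarith) (by linarith) (by linarith)
      hqb hpa hK ?_
    rw [hKd]
    congr 1 <;> ring

/-- The dilatation at `(x, y)` is controlled by the distortion at three nearby points. -/
lemma le_mul_max_rhoDist {h : ℝ → ℝ} (hm : StrictMono h) {x y K : ℝ} (hy : 0 < y)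
    (hK : 1 ≤ K) (hKd : K + K⁻¹ = BAdil h x y) :
    K ≤ 32 * max (rhoDist h x y)
      (max (rhoDist h (x - y / 4) (y / 2)) (rhoDist h (x + y / 4) (y / 2))) := by
  obtain ⟨p, q, hpa, hqb, hp, hq, e⟩ := exists_BAdil_eq hm x hy
  have h1 : h (x + y / 4) < h (x + y) := hm (by linarith)
  have h2 : h (x - y) < h (x - y / 4) := hm (by linarith)
  have h3 : h x < h (x + y / 4) := hm (by linarith)
  have h4 : h (x - y / 4) < h x := hm (by linarith)
  have h5 : h (x + y / 4) < h (x + 3 * y / 4) := hm (by linarith)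
  have h6 : h (x + 3 * y / 4) < h (x + y) := hm (by linarith)
  have h7 : h (x - 3 * y / 4) < h (x - y / 4) := hm (by linarith)
  have h8 : h (x - y) < h (x - 3 * y / 4) := hm (by linarith)
  rw [e] at hKd
  rcases le_total (h x - h (x - y)) (h (x + y) - h x) with hab | hab
  · refine le_of_add_inv_eq (by linarith) (by linarith) (by linarith) hpa hqb hab hK hKd
      (le_max_of_le_left (le_max_left _ _))
      fun hp8 => le_max_of_le_right (le_max_of_le_left (le_max_of_le_left ?_))
    rw [show x - y / 4 + y / 2 = x + y / 4 by ring, show x - y / 4 - y / 2 = x - 3 * y / 4 by ring]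
    rw [div_le_div_iff₀ (by linarith) (by linarith)]
    nlinarith
  · refine le_of_add_inv_eq (p := q) (q := p) (by linarith) (by linarith) (by linarith)
      hqb hpa hab hK ?_ (le_max_of_le_left (le_max_right _ _))
      fun hq8 => le_max_of_le_right (le_max_of_le_right (le_max_of_le_right ?_))
    · rw [hKd]
      congr 1 <;> ring
    · rw [show x + y / 4 + y / 2 = x + 3 * y / 4 by ring,
        show x + y / 4 - y / 2 = x - y / 4 by ring]
      rw [div_le_div_iff₀ (by linarith) (by linarith)]
      nlinarith

lemma measurableSet_upperHP : MeasurableSet upperHP :=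
  measurableSet_lt measurable_const measurable_snd

lemma measurable_sphDen : Measurable sphDen := by
  unfold sphDen
  fun_prop

lemma sphDen_nonneg (p : ℝ × ℝ) : 0 ≤ sphDen p := by
  unfold sphDen
  positivity

lemma measurable_rhoDist {h : ℝ → ℝ} (hh : Measurable h) :
    Measurable fun p : ℝ × ℝ => rhoDist h p.1 p.2 := by
  unfold rhoDist
  fun_prop

/-- Change of variables `(x, y) ↦ (x + c y, y / 2)`. -/
lemma lintegral_comp_shear {F : ℝ × ℝ → ENNReal} (hF : Measurable F) (c : ℝ) :
    ∫⁻ p : ℝ × ℝ, F (p.1 + c * p.2, p.2 / 2) = 2 * ∫⁻ p, F p := by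
  let T : ℝ × ℝ →ₗ[ℝ] ℝ × ℝ :=
    { toFun := fun p => (p.1 + c * p.2, p.2 / 2)
      map_add' := fun p q => by ext <;> simp <;> ring
      map_smul' := fun r p => by ext <;> simp <;> ring }
  have hdet : LinearMap.det T = 1 / 2 := by
    rw [← LinearMap.det_toMatrix (Module.Basis.finTwoProd ℝ), Matrix.det_fin_two]
    simp [LinearMap.toMatrix_apply, T]
  have hT : Measurable T := T.continuous_of_finiteDimensional.measurable
  have hmap := Measure.map_linearMap_addHaar_eq_smul_addHaar (volume : Measure (ℝ × ℝ))
    (f := T) (by rw [hdet]; norm_num)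
  calc ∫⁻ p : ℝ × ℝ, F (p.1 + c * p.2, p.2 / 2) = ∫⁻ p, F p ∂(Measure.map T volume) :=
        (lintegral_map hF hT).symm
    _ = 2 * ∫⁻ p, F p := by
        rw [hmap, hdet, lintegral_smul_measure]
        norm_num

lemma sphDen_le_of_shear (x y c : ℝ) (hc : c ^ 2 = 1 / 16) :
    sphDen (x, y) ≤ 4 * sphDen (x + c * y, y / 2) := by
  unfold sphDen
  dsimp only
  rw [← mul_div_assoc, div_le_div_iff₀ (by positivity) (by positivity)]
  have hS : 1 + (x + c * y) ^ 2 + (y / 2) ^ 2 ≤ 2 * (1 + x ^ 2 + y ^ 2) := by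
    nlinarith [sq_nonneg (x - c * y)]
  nlinarith [pow_le_pow_left₀ (by positivity) hS 2]

/-- Moving the argument of the integrand by a shear costs at most a constant factor. -/
lemma setLIntegral_comp_shear_le {g : ℝ × ℝ → ℝ} (hg : Measurable g) (hg₀ : ∀ p, 0 ≤ g p)
    {c : ℝ} (hc : c ^ 2 = 1 / 16) :
    ∫⁻ p in upperHP, ENNReal.ofReal (g (p.1 + c * p.2, p.2 / 2) * sphDen p) ≤
      8 * ∫⁻ p in upperHP, ENNReal.ofReal (g p * sphDen p) := by
  let F : ℝ × ℝ → ENNReal := upperHP.indicator fun p => ENNReal.ofReal (g p * sphDen p)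
  have hF : Measurable F :=
    ((hg.mul measurable_sphDen).ennreal_ofReal).indicator measurableSet_upperHP
  have hle : ∀ p ∈ upperHP, ENNReal.ofReal (g (p.1 + c * p.2, p.2 / 2) * sphDen p) ≤
      4 * F (p.1 + c * p.2, p.2 / 2) := fun p hp => by
    have hp' : (p.1 + c * p.2, p.2 / 2) ∈ upperHP := half_pos (show 0 < p.2 from hp)
    rw [show F _ = _ from indicator_of_mem hp' _,
      show (4 : ENNReal) = ENNReal.ofReal 4 by norm_num, ← ENNReal.ofReal_mul (by norm_num)]
    refine ENNReal.ofReal_le_ofReal ?_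
    nlinarith [mul_le_mul_of_nonneg_left (sphDen_le_of_shear p.1 p.2 c hc)
      (hg₀ (p.1 + c * p.2, p.2 / 2))]
  calc _ ≤ ∫⁻ p in upperHP, 4 * F (p.1 + c * p.2, p.2 / 2) :=
        setLIntegral_mono' measurableSet_upperHP hle
    _ ≤ ∫⁻ p : ℝ × ℝ, 4 * F (p.1 + c * p.2, p.2 / 2) := setLIntegral_le_lintegral _ _
    _ = 4 * (2 * ∫⁻ p, F p) := by
        rw [lintegral_const_mul' _ _ (by norm_num), lintegral_comp_shear hF]
    _ = _ := by
        rw [lintegral_indicator measurableSet_upperHP, ← mul_assoc]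
        norm_num

/-- There exist uniform constants `C₀ > 0` and `C > 0` such that for every
increasing convex `Φ : [0,∞) → [0,∞)`, every increasing homeomorphism `h : ℝ → ℝ` with
Beurling–Ahlfors quasiconformal dilatation `K`, and every `q > 0`:
`∫_ℍ Φ(q(4C₀)⁻¹ ρ_h) dσ ≤ ∫_ℍ Φ(qC₀⁻¹ K) dσ ≤ C ∫_ℍ Φ(q ρ_h) dσ`. -/
theorem integral_convex_dilatation_bounds :
    ∃ C₀ C : ℝ, 0 < C₀ ∧ 0 < C ∧
      ∀ (Φ : ℝ → ℝ), ConvexOn ℝ (Ici 0) Φ → MonotoneOn Φ (Ici 0) →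
        (∀ x ∈ Ici (0 : ℝ), 0 ≤ Φ x) →
      ∀ (h : ℝ → ℝ), StrictMono h → Surjective h →
      ∀ (K : ℝ → ℝ → ℝ),
        (∀ x y : ℝ, 0 < y → 1 ≤ K x y ∧ K x y + (K x y)⁻¹ = BAdil h x y) →
      ∀ q : ℝ, 0 < q →
        (∫⁻ p in upperHP, ENNReal.ofReal (Φ (q * (4 * C₀)⁻¹ * rhoDist h p.1 p.2) * sphDen p)
            ≤ ∫⁻ p in upperHP, ENNReal.ofReal (Φ (q * C₀⁻¹ * K p.1 p.2) * sphDen p)) ∧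
        (∫⁻ p in upperHP, ENNReal.ofReal (Φ (q * C₀⁻¹ * K p.1 p.2) * sphDen p)
            ≤ ENNReal.ofReal C *
              ∫⁻ p in upperHP, ENNReal.ofReal (Φ (q * rhoDist h p.1 p.2) * sphDen p)) := by
  refine ⟨32, 17, by norm_num, by norm_num, ?_⟩
  intro Φ _ hΦm hΦ₀ h hm _ K hK q hq
  constructor
  · refine setLIntegral_mono' measurableSet_upperHP fun p (hp : 0 < p.2) => ?_
    have hρ := rhoDist_pos hm p.1 hp
    obtain ⟨hK₁, hKd⟩ := hK p.1 p.2 hp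
    have hle := rhoDist_le_four_mul hm hp hK₁ hKd
    refine ENNReal.ofReal_le_ofReal (mul_le_mul_of_nonneg_right ?_ (sphDen_nonneg p))
    refine hΦm (mem_Ici.2 (by positivity)) (mem_Ici.2 (by positivity)) ?_
    calc q * (4 * 32)⁻¹ * rhoDist h p.1 p.2 ≤ q * (4 * 32)⁻¹ * (4 * K p.1 p.2) := by gcongr
      _ = q * 32⁻¹ * K p.1 p.2 := by ring
  · let g : ℝ × ℝ → ℝ := fun p => Φ (max 0 (q * rhoDist h p.1 p.2))
    have hΦmax : Monotone fun t => Φ (max 0 t) := fun s t hst =>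
      hΦm (mem_Ici.2 (le_max_left _ _)) (mem_Ici.2 (le_max_left _ _)) (max_le_max le_rfl hst)
    have hg : Measurable g := hΦmax.measurable.comp
      ((measurable_rhoDist hm.monotone.measurable).const_mul q)
    have hg₀ : ∀ p, 0 ≤ g p := fun p => hΦ₀ _ (mem_Ici.2 (le_max_left _ _))
    have hgeq : ∀ p ∈ upperHP, g p = Φ (q * rhoDist h p.1 p.2) := fun p (hp : 0 < p.2) => by
      have := rhoDist_pos hm p.1 hp
      exact congrArg Φ (max_eq_right (by positivity))
    let G : ℝ → ℝ × ℝ → ENNReal := fun c p =>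
      ENNReal.ofReal (g (p.1 + c * p.2, p.2 / 2) * sphDen p)
    let G₀ : ℝ × ℝ → ENNReal := fun p => ENNReal.ofReal (g p * sphDen p)
    have hG : ∀ c, Measurable (G c) := fun c =>
      ((hg.comp (by fun_prop)).mul measurable_sphDen).ennreal_ofReal
    have hG₀ : Measurable G₀ := (hg.mul measurable_sphDen).ennreal_ofReal
    have hpt : ∀ p ∈ upperHP, ENNReal.ofReal (Φ (q * 32⁻¹ * K p.1 p.2) * sphDen p) ≤
        G₀ p + (G (-1 / 4) p + G (1 / 4) p) := fun p (hp : 0 < p.2) => by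
      obtain ⟨hK₁, hKd⟩ := hK p.1 p.2 hp
      have hle := le_mul_max_rhoDist hm hp hK₁ hKd
      have key : ∀ r, K p.1 p.2 ≤ 32 * r →
          ENNReal.ofReal (Φ (q * 32⁻¹ * K p.1 p.2) * sphDen p) ≤
            ENNReal.ofReal (Φ (max 0 (q * r)) * sphDen p) := fun r hr => by
        refine ENNReal.ofReal_le_ofReal (mul_le_mul_of_nonneg_right ?_ (sphDen_nonneg p))
        refine hΦm (mem_Ici.2 (by positivity)) (mem_Ici.2 (le_max_left _ _)) (le_max_of_le_right ?_)
        calc q * 32⁻¹ * K p.1 p.2 ≤ q * 32⁻¹ * (32 * r) := by gcongr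
          _ = q * r := by ring
      rw [mul_max_of_nonneg _ _ (by norm_num), mul_max_of_nonneg _ _ (by norm_num), le_max_iff,
        le_max_iff] at hle
      rcases hle with hle | hle | hle
      · exact (key _ hle).trans le_self_add
      · refine (key _ hle).trans ?_
        rw [show p.1 - p.2 / 4 = p.1 + -1 / 4 * p.2 by ring]
        exact le_add_left le_self_add
      · refine (key _ hle).trans ?_
        rw [show p.1 + p.2 / 4 = p.1 + 1 / 4 * p.2 by ring]
        exact le_add_left le_add_self
    calc _ ≤ ∫⁻ p in upperHP, (G₀ p + (G (-1 / 4) p + G (1 / 4) p)) :=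
          setLIntegral_mono' measurableSet_upperHP hpt
      _ = (∫⁻ p in upperHP, G₀ p) +
            ((∫⁻ p in upperHP, G (-1 / 4) p) + ∫⁻ p in upperHP, G (1 / 4) p) := by
          rw [lintegral_add_left hG₀, lintegral_add_left (hG _)]
      _ ≤ (∫⁻ p in upperHP, G₀ p) +
            (8 * (∫⁻ p in upperHP, G₀ p) + 8 * ∫⁻ p in upperHP, G₀ p) := by
          gcongr <;> exact setLIntegral_comp_shear_le hg hg₀ (by norm_num)
      _ = ENNReal.ofReal 17 * ∫⁻ p in upperHP, G₀ p := by
          rw [show ENNReal.ofReal 17 = 1 + (8 + 8) by norm_num]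
          ring
      _ = _ := by
          congr 1
          refine setLIntegral_congr_fun measurableSet_upperHP fun p hp => ?_
          simp only [G₀, hgeq p hp]
end
end

section
/- Let h : ℝ → ℝ be an increasing homeomorphism such that ∫_ℍ e^{q ρ_h(x,y)} dσ(x,y) < ∞ for some q > 0. Then h extends to a homeomorphism of the closed upper half-plane with exponentially integrable distortion; concretely, the Beurling–Ahlfors extension H of h is a homeomorphism of the closed upper half-plane extending h, and there exists p > 0 such that ∫_ℍ e^{p K_h(x,y)} dσ(x,y) < ∞. -/
open MeasureTheory Set Function

noncomputable section

/-- The real part `u` of the Beurling–Ahlfors extension. -/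
def BAu (h : ℝ → ℝ) (x y : ℝ) : ℝ := (1 / (2 * y)) * ∫ t in (x - y)..(x + y), h t

/-- The imaginary part `v` of the Beurling–Ahlfors extension. -/
def BAv (h : ℝ → ℝ) (x y : ℝ) : ℝ :=
  (1 / (2 * y)) * ((∫ t in x..(x + y), h t) - ∫ t in (x - y)..x, h t)

/-- The Beurling–Ahlfors extension of `h`, as a map `ℝ × ℝ → ℝ × ℝ`
(defined to be `(h x, 0)` on the real line). -/
def BAext (h : ℝ → ℝ) (p : ℝ × ℝ) : ℝ × ℝ :=
  if 0 < p.2 then (BAu h p.1 p.2, BAv h p.1 p.2) else (h p.1, 0)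

/-- The closed upper half-plane, as a subset of `ℝ × ℝ`. -/
def upperHPc : Set (ℝ × ℝ) := {p | 0 ≤ p.2}

/-- The mean of `h` over the segment from `x` to `x + y`, for `y` of either sign. -/
def segMean (h : ℝ → ℝ) (x y : ℝ) : ℝ := ∫ s in (0 : ℝ)..1, h (x + y * s)

section Mean

theorem Monotone.le_integral_zero_one {f : ℝ → ℝ} (hf : Monotone f) {θ : ℝ}
    (h0 : 0 ≤ θ) (h1 : θ ≤ 1) :
    θ * f 0 + (1 - θ) * f θ ≤ ∫ s in (0 : ℝ)..1, f s := by
  have hi : ∀ a b : ℝ, IntervalIntegrable f volume a b := fun a b => hf.intervalIntegrable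
  rw [← intervalIntegral.integral_add_adjacent_intervals (hi 0 θ) (hi θ 1)]
  have e1 : ∫ _ in (0 : ℝ)..θ, f 0 ≤ ∫ s in (0 : ℝ)..θ, f s :=
    intervalIntegral.integral_mono_on h0 (by simp) (hi _ _) fun s hs => hf hs.1
  have e2 : ∫ _ in θ..1, f θ ≤ ∫ s in θ..1, f s :=
    intervalIntegral.integral_mono_on h1 (by simp) (hi _ _) fun s hs => hf hs.1
  simp only [intervalIntegral.integral_const, smul_eq_mul, sub_zero] at e1 e2
  linarith

theorem Monotone.integral_zero_one_le {f : ℝ → ℝ} (hf : Monotone f) {θ : ℝ}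
    (h0 : 0 ≤ θ) (h1 : θ ≤ 1) :
    ∫ s in (0 : ℝ)..1, f s ≤ θ * f θ + (1 - θ) * f 1 := by
  have hi : ∀ a b : ℝ, IntervalIntegrable f volume a b := fun a b => hf.intervalIntegrable
  rw [← intervalIntegral.integral_add_adjacent_intervals (hi 0 θ) (hi θ 1)]
  have e1 : ∫ s in (0 : ℝ)..θ, f s ≤ ∫ _ in (0 : ℝ)..θ, f θ :=
    intervalIntegral.integral_mono_on h0 (hi _ _) (by simp) fun s hs => hf hs.2
  have e2 : ∫ s in θ..1, f s ≤ ∫ _ in θ..1, f 1 :=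
    intervalIntegral.integral_mono_on h1 (hi _ _) (by simp) fun s hs => hf hs.2
  simp only [intervalIntegral.integral_const, smul_eq_mul, sub_zero] at e1 e2
  linarith

variable {h : ℝ → ℝ}

theorem segMean_zero (h : ℝ → ℝ) (x : ℝ) : segMean h x 0 = h x := by simp [segMean]

theorem mul_segMean (h : ℝ → ℝ) (x y : ℝ) : y * segMean h x y = ∫ t in x..(x + y), h t := by
  simp [segMean]

theorem mul_segMean_neg (h : ℝ → ℝ) (x y : ℝ) :
    y * segMean h x (-y) = ∫ t in (x - y)..x, h t := by
  have := mul_segMean h x (-y)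
  rw [intervalIntegral.integral_symm, ← sub_eq_add_neg] at this
  linarith

theorem continuous_segMean (hc : Continuous h) : Continuous fun p : ℝ × ℝ => segMean h p.1 p.2 := by
  unfold segMean
  apply intervalIntegral.continuous_parametric_intervalIntegral_of_continuous'
  fun_prop

theorem segMean_lt_segMean (hmono : StrictMono h) (hc : Continuous h) {x y x' y' : ℝ}
    (hx : x ≤ x') (hy : x + y ≤ x' + y') (hlt : x < x' ∨ x + y < x' + y') :
    segMean h x y < segMean h x' y' := by
  apply intervalIntegral.integral_lt_integral_of_continuousOn_of_le_of_exists_lt one_pos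
    (by fun_prop) (by fun_prop)
  · intro s hs
    apply hmono.monotone
    nlinarith [mul_nonneg (sub_nonneg.2 hs.2) (sub_nonneg.2 hx),
      mul_nonneg hs.1.le (sub_nonneg.2 hy)]
  · rcases hlt with hlt | hlt
    · exact ⟨0, by simp, hmono (by simpa using hlt)⟩
    · exact ⟨1, by simp, hmono (by simpa using hlt)⟩

theorem strictMono_segMean (hmono : StrictMono h) (hc : Continuous h) (x : ℝ) :
    StrictMono (segMean h x) := fun _ _ hyy =>
  segMean_lt_segMean hmono hc le_rfl (by linarith) (Or.inr (by linarith))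

theorem le_segMean (hm : Monotone h) {θ : ℝ} (h0 : 0 ≤ θ) (h1 : θ ≤ 1) (x : ℝ) {y : ℝ}
    (hy : 0 ≤ y) : θ * h x + (1 - θ) * h (x + y * θ) ≤ segMean h x y := by
  have hf : Monotone fun s => h (x + y * s) := fun s t hst => hm (by gcongr)
  simpa [segMean] using hf.le_integral_zero_one h0 h1

theorem segMean_le (hm : Monotone h) {θ : ℝ} (h0 : 0 ≤ θ) (h1 : θ ≤ 1) (x : ℝ) {y : ℝ}
    (hy : 0 ≤ y) : segMean h x y ≤ θ * h (x + y * θ) + (1 - θ) * h (x + y) := by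
  have hf : Monotone fun s => h (x + y * s) := fun s t hst => hm (by gcongr)
  simpa [segMean] using hf.integral_zero_one_le h0 h1

theorem segMean_neg_le (hm : Monotone h) {θ : ℝ} (h0 : 0 ≤ θ) (h1 : θ ≤ 1) (x : ℝ) {y : ℝ}
    (hy : 0 ≤ y) : segMean h x (-y) ≤ θ * h x + (1 - θ) * h (x - y * θ) := by
  have hf : Monotone fun s => -h (x + -y * s) :=
    fun s t hst => neg_le_neg (hm (by nlinarith))
  have := hf.le_integral_zero_one h0 h1
  rw [intervalIntegral.integral_neg] at this
  simp only [mul_zero, add_zero, neg_mul, ← sub_eq_add_neg] at this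
  simp only [segMean, neg_mul, ← sub_eq_add_neg]
  linarith

theorem le_segMean_neg (hm : Monotone h) {θ : ℝ} (h0 : 0 ≤ θ) (h1 : θ ≤ 1) (x : ℝ) {y : ℝ}
    (hy : 0 ≤ y) : θ * h (x - y * θ) + (1 - θ) * h (x - y) ≤ segMean h x (-y) := by
  have hf : Monotone fun s => -h (x + -y * s) :=
    fun s t hst => neg_le_neg (hm (by nlinarith))
  have := hf.integral_zero_one_le h0 h1
  rw [intervalIntegral.integral_neg] at this
  simp only [mul_one, neg_mul, ← sub_eq_add_neg] at this
  simp only [segMean, neg_mul, ← sub_eq_add_neg]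
  linarith

theorem surjective_segMean (hmono : StrictMono h) (hsurj : Surjective h) (hc : Continuous h)
    (x : ℝ) : Surjective (segMean h x) := by
  intro c
  have hcont : Continuous (segMean h x) :=
    (continuous_segMean hc).comp (by fun_prop : Continuous fun y : ℝ => (x, y))
  obtain ⟨t, ht⟩ := hsurj (2 * c - h x)
  have key : ∃ y₀ y₁, segMean h x y₀ ≤ c ∧ c ≤ segMean h x y₁ := by
    rcases le_total (h x) c with hxc | hxc
    · refine ⟨0, 2 * (t - x), by rwa [segMean_zero], ?_⟩
      have htx : x ≤ t := hmono.le_iff_le.1 (by linarith)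
      have := le_segMean hmono.monotone (θ := 1 / 2) (by norm_num) (by norm_num) x
        (y := 2 * (t - x)) (by linarith)
      rw [show x + 2 * (t - x) * (1 / 2) = t by ring] at this
      linarith
    · refine ⟨-(2 * (x - t)), 0, ?_, by rwa [segMean_zero]⟩
      have htx : t ≤ x := hmono.le_iff_le.1 (by linarith)
      have := segMean_neg_le hmono.monotone (θ := 1 / 2) (by norm_num) (by norm_num) x
        (y := 2 * (x - t)) (by linarith)
      rw [show x - 2 * (x - t) * (1 / 2) = t by ring] at this
      linarith
  obtain ⟨y₀, y₁, h0, h1⟩ := key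
  exact intermediate_value_univ y₀ y₁ hcont ⟨h0, h1⟩

end Mean

section Extension

variable {h : ℝ → ℝ}

theorem BAext_eq_segMean (hc : Continuous h) {p : ℝ × ℝ} (hp : 0 ≤ p.2) :
    BAext h p = ((segMean h p.1 p.2 + segMean h p.1 (-p.2)) / 2,
      (segMean h p.1 p.2 - segMean h p.1 (-p.2)) / 2) := by
  obtain ⟨x, y⟩ := p
  rcases hp.eq_or_lt with h0 | hy
  · simp only at h0
    subst h0
    simp [BAext, segMean_zero]
  · simp only at hy
    have hi : ∀ a b : ℝ, IntervalIntegrable h volume a b := fun a b => hc.intervalIntegrable a b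
    simp only [BAext, hy, if_true, BAu, BAv]
    rw [← intervalIntegral.integral_add_adjacent_intervals (hi (x - y) x) (hi x (x + y)),
      ← mul_segMean, ← mul_segMean_neg]
    ext <;> simp only <;> field_simp
    ring

theorem segMean_pair_inj (hmono : StrictMono h) (hc : Continuous h) {x₁ y₁ x₂ y₂ : ℝ}
    (hp : segMean h x₁ y₁ = segMean h x₂ y₂) (hn : segMean h x₁ (-y₁) = segMean h x₂ (-y₂)) :
    x₁ = x₂ ∧ y₁ = y₂ := by
  wlog hx : x₁ ≤ x₂ generalizing x₁ y₁ x₂ y₂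
  · have := this hp.symm hn.symm (le_of_not_ge hx)
    exact ⟨this.1.symm, this.2.symm⟩
  rcases le_or_gt (x₁ + y₁) (x₂ + y₂) with hy | hy
  · have : ¬ (x₁ < x₂ ∨ x₁ + y₁ < x₂ + y₂) := fun hlt =>
      (segMean_lt_segMean hmono hc hx hy hlt).ne hp
    push Not at this
    constructor <;> linarith
  · exact absurd hn
      (segMean_lt_segMean hmono hc hx (by linarith) (Or.inr (by linarith))).ne

theorem exists_segMean_pair (hmono : StrictMono h) (hsurj : Surjective h) (hc : Continuous h)
    {α β : ℝ} (hβα : β ≤ α) :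
    ∃ x y, 0 ≤ y ∧ segMean h x y = α ∧ segMean h x (-y) = β := by
  have hcont := continuous_segMean hc
  choose Y hY using fun x => surjective_segMean hmono hsurj hc x α
  have hYc : Continuous Y := by
    rw [continuous_iff_continuousAt]
    intro x
    refine tendsto_order.2 ⟨fun l hl => ?_, fun u hu => ?_⟩
    · have h1 : segMean h x l < α := by
        rw [← hY x]; exact strictMono_segMean hmono hc x hl
      have h2 : Continuous fun z => segMean h z l :=
        hcont.comp (by fun_prop : Continuous fun z : ℝ => (z, l))
      filter_upwards [h2.continuousAt.eventually_lt_const h1] with z hz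
      rw [← hY z] at hz
      exact (strictMono_segMean hmono hc z).lt_iff_lt.1 hz
    · have h1 : α < segMean h x u := by
        rw [← hY x]; exact strictMono_segMean hmono hc x hu
      have h2 : Continuous fun z => segMean h z u :=
        hcont.comp (by fun_prop : Continuous fun z : ℝ => (z, u))
      filter_upwards [h2.continuousAt.eventually_const_lt h1] with z hz
      rw [← hY z] at hz
      exact (strictMono_segMean hmono hc z).lt_iff_lt.1 hz
  have hYnonneg : ∀ x, h x ≤ α → 0 ≤ Y x := fun x hx => by
    rw [← (strictMono_segMean hmono hc x).le_iff_le, hY, segMean_zero]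
    exact hx
  obtain ⟨a, ha⟩ := hsurj α
  obtain ⟨b, hb⟩ := hsurj β
  have hba : b ≤ a := hmono.le_iff_le.1 (by rwa [ha, hb])
  have hYa : Y a = 0 := (strictMono_segMean hmono hc a).injective (by rw [hY, segMean_zero, ha])
  have hg : Continuous fun x => segMean h x (-Y x) :=
    hcont.comp (by fun_prop : Continuous fun x : ℝ => (x, -Y x))
  have hgb : segMean h b (-Y b) ≤ β := by
    rw [← hb, ← segMean_zero h b]
    refine (strictMono_segMean hmono hc b).monotone ?_
    have := hYnonneg b (by rwa [hb])
    linarith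
  have hga : β ≤ segMean h a (-Y a) := by rw [hYa, neg_zero, segMean_zero, ha]; exact hβα
  obtain ⟨x, hx, hxβ⟩ := intermediate_value_Icc hba hg.continuousOn ⟨hgb, hga⟩
  exact ⟨x, Y x, hYnonneg x (by rw [← ha]; exact hmono.monotone hx.2), hY x, hxβ⟩

theorem exists_bound_of_segMean_bound (hmono : StrictMono h) (hsurj : Surjective h)
    (hc : Continuous h) (M : ℝ) :
    ∃ l u : ℝ, ∀ x y, 0 ≤ y → segMean h x y ≤ M → -M ≤ segMean h x (-y) →
      x ∈ Icc l u ∧ y ∈ Icc 0 (2 * (u - l)) := by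
  obtain ⟨l, hl⟩ := hsurj (-M)
  obtain ⟨u₁, hu₁⟩ := hsurj M
  obtain ⟨u₂, hu₂⟩ := hsurj (3 * M)
  refine ⟨l, max u₁ u₂, fun x y hy hM hM' => ?_⟩
  have hxM : h x ≤ M := by
    refine le_trans ?_ hM
    rw [← segMean_zero h x]
    exact (strictMono_segMean hmono hc x).monotone hy
  have hxM' : -M ≤ h x := by
    refine le_trans hM' ?_
    rw [← segMean_zero h x]
    exact (strictMono_segMean hmono hc x).monotone (by linarith)
  have hlx : l ≤ x := hmono.le_iff_le.1 (by linarith)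
  have hxu : x ≤ u₁ := hmono.le_iff_le.1 (by linarith)
  have h3 := le_segMean hmono.monotone (θ := 1 / 2) (by norm_num) (by norm_num) x hy
  have hxy : x + y * (1 / 2) ≤ u₂ := hmono.le_iff_le.1 (by linarith)
  refine ⟨⟨hlx, hxu.trans (le_max_left _ _)⟩, hy, ?_⟩
  have := le_max_right u₁ u₂
  linarith

/-- The Beurling–Ahlfors extension as a self-map of the closed upper half-plane. -/
theorem exists_homeomorph_BAext (hmono : StrictMono h) (hsurj : Surjective h) :
    ∃ E : upperHPc ≃ₜ upperHPc, ∀ p : upperHPc, (E p : ℝ × ℝ) = BAext h p := by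
  have hc : Continuous h := hmono.monotone.continuous_of_surjective hsurj
  have hcont := continuous_segMean hc
  have hmem : ∀ p : upperHPc, BAext h p ∈ upperHPc := fun p => by
    have hp : (0 : ℝ) ≤ p.1.2 := p.2
    have := (strictMono_segMean hmono hc p.1.1).monotone (by linarith : -p.1.2 ≤ p.1.2)
    rw [BAext_eq_segMean hc hp]
    change (0 : ℝ) ≤ _
    simp only
    linarith
  let F : upperHPc → upperHPc := fun p => ⟨BAext h p, hmem p⟩
  have hFval : ∀ p, (F p : ℝ × ℝ) = ((segMean h p.1.1 p.1.2 + segMean h p.1.1 (-p.1.2)) / 2,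
      (segMean h p.1.1 p.1.2 - segMean h p.1.1 (-p.1.2)) / 2) := fun p =>
    BAext_eq_segMean hc p.2
  have hFc : Continuous F := by
    refine continuous_induced_rng.2 ?_
    have e1 : Continuous fun p : upperHPc => segMean h p.1.1 p.1.2 :=
      hcont.comp (by fun_prop : Continuous fun p : upperHPc => (p.1.1, p.1.2))
    have e2 : Continuous fun p : upperHPc => segMean h p.1.1 (-p.1.2) :=
      hcont.comp (by fun_prop : Continuous fun p : upperHPc => (p.1.1, -p.1.2))
    have : (Subtype.val ∘ F) = fun p : upperHPc =>
        ((segMean h p.1.1 p.1.2 + segMean h p.1.1 (-p.1.2)) / 2,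
          (segMean h p.1.1 p.1.2 - segMean h p.1.1 (-p.1.2)) / 2) := funext hFval
    rw [this]
    fun_prop
  have hFinj : Injective F := by
    intro p p' hpp
    have h1 := congrArg Subtype.val hpp
    rw [hFval, hFval, Prod.mk.injEq] at h1
    obtain ⟨e1, e2⟩ := segMean_pair_inj hmono hc (x₁ := p.1.1) (y₁ := p.1.2) (x₂ := p'.1.1)
      (y₂ := p'.1.2) (by linarith [h1.1, h1.2]) (by linarith [h1.1, h1.2])
    exact Subtype.ext (Prod.ext e1 e2)
  have hFsurj : Surjective F := by
    rintro ⟨⟨U, V⟩, hV⟩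
    have hV' : (0 : ℝ) ≤ V := hV
    obtain ⟨x, y, hy, e1, e2⟩ := exists_segMean_pair hmono hsurj hc
      (by linarith : U - V ≤ U + V)
    refine ⟨⟨(x, y), hy⟩, Subtype.ext ?_⟩
    rw [hFval]
    simp only [e1, e2]
    ext <;> simp only <;> ring
  have hclosed : IsClosed upperHPc := isClosed_le continuous_const continuous_snd
  have hproper : IsProperMap F := by
    rw [isProperMap_iff_isCompact_preimage]
    refine ⟨hFc, fun S hS => ?_⟩
    obtain ⟨R, hR⟩ := (hS.image continuous_subtype_val).isBounded.exists_norm_le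
    obtain ⟨l, u, hlu⟩ := exists_bound_of_segMean_bound hmono hsurj hc (2 * R)
    have hbox : IsCompact ((Subtype.val : upperHPc → ℝ × ℝ) ⁻¹'
        (Icc l u ×ˢ Icc 0 (2 * (u - l)))) :=
      hclosed.isClosedEmbedding_subtypeVal.isCompact_preimage (isCompact_Icc.prod isCompact_Icc)
    refine hbox.of_isClosed_subset (hS.isClosed.preimage hFc) fun p hp => ?_
    have hn := hR _ ⟨F p, hp, rfl⟩
    rw [hFval, Prod.norm_def] at hn
    have h1 := abs_le.1 ((le_max_left _ _).trans hn)
    have h2 := abs_le.1 ((le_max_right _ _).trans hn)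
    simp only at h1 h2
    exact hlu p.1.1 p.1.2 p.2 (by linarith [h1.2, h2.2]) (by linarith [h1.1, h2.2])
  exact ⟨(Equiv.ofBijective F ⟨hFinj, hFsurj⟩).toHomeomorphOfContinuousClosed hFc
    hproper.isClosedMap, fun p => rfl⟩

end Extension

section Dilatation

variable {h : ℝ → ℝ}

theorem BAdil_eq_segMean (h : ℝ → ℝ) (x : ℝ) {y : ℝ} (hy : 0 < y) :
    BAdil h x y =
      ((h (x + y) - h x) ^ 2 + (h x - h (x - y)) ^ 2 + (h (x + y) - segMean h x y) ^ 2 +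
          (segMean h x (-y) - h (x - y)) ^ 2) /
        ((h (x + y) - h x) * (segMean h x (-y) - h (x - y)) +
          (h x - h (x - y)) * (h (x + y) - segMean h x y)) := by
  have hy' : y ≠ 0 := hy.ne'
  have e1 : 1 / y * (y * segMean h x y) = segMean h x y := by field_simp
  have e2 : 1 / y * (y * segMean h x (-y)) = segMean h x (-y) := by field_simp
  simp only [BAdil, BAux, BAuy, BAvx, BAvy, ← mul_segMean, ← mul_segMean_neg, e1, e2]
  have hc : 2 * y ^ 2 ≠ 0 := by positivity
  rw [← mul_div_mul_left _ _ hc]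
  congr 1 <;> field_simp <;> ring

theorem dilatation_le_of_le {a b ξ η c M N : ℝ} (hb : 0 < b) (hba : b ≤ a) (hξ : 0 < ξ)
    (hξa : ξ ≤ a) (hη : 0 < η) (hηb : η ≤ b) (hξc : (a - c) / 2 ≤ ξ) (hM : 0 < M)
    (hηM : M / 4 ≤ η) (hN : c ≤ N) :
    (a ^ 2 + b ^ 2 + ξ ^ 2 + η ^ 2) / (a * η + b * ξ) ≤ 32 * max (a / b) (N / M) := by
  have ha : 0 < a := hb.trans_le hba
  have hnum : a ^ 2 + b ^ 2 + ξ ^ 2 + η ^ 2 ≤ 4 * a ^ 2 := by nlinarith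
  have haη : 0 < a * η := mul_pos ha hη
  have hbξ : 0 < b * ξ := mul_pos hb hξ
  rcases le_total (a / 2) c with hc | hc
  · refine le_trans ?_ (mul_le_mul_of_nonneg_left (le_max_right _ _) (by norm_num))
    rw [mul_div_assoc', div_le_div_iff₀ (by positivity) hM]
    have h1 : 4 * a ^ 2 * M ≤ 4 * a ^ 2 * (4 * η) := by gcongr; linarith
    have h2 : (a ^ 2 + b ^ 2 + ξ ^ 2 + η ^ 2) * M ≤ 4 * a ^ 2 * M := by gcongr
    have h3 : 32 * (a / 2) * (a * η) ≤ 32 * N * (a * η + b * ξ) := by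
      gcongr <;> linarith
    nlinarith
  · refine le_trans ?_ (mul_le_mul_of_nonneg_left (le_max_left _ _) (by norm_num))
    rw [mul_div_assoc', div_le_div_iff₀ (by positivity) hb]
    have h2 : (a ^ 2 + b ^ 2 + ξ ^ 2 + η ^ 2) * b ≤ 4 * a ^ 2 * b := by gcongr
    have h3 : 32 * a * (b * (a / 4)) ≤ 32 * a * (a * η + b * ξ) := by
      gcongr
      nlinarith
    nlinarith [mul_pos (mul_pos ha ha) hb]

/-- The dilatation of the Beurling–Ahlfors extension is controlled by the symmetric distortion
at three points. -/
theorem BAdil_le_rhoDist (hmono : StrictMono h) (hc : Continuous h) (x : ℝ) {y : ℝ}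
    (hy : 0 < y) :
    BAdil h x y ≤ 32 * max (rhoDist h x y)
      (max (rhoDist h (x - y / 4) (3 * y / 4)) (rhoDist h (x + y / 4) (3 * y / 4))) := by
  have hm := hmono.monotone
  rw [BAdil_eq_segMean h x hy]
  have ha : 0 < h (x + y) - h x := sub_pos.2 (hmono (by linarith))
  have hb : 0 < h x - h (x - y) := sub_pos.2 (hmono (by linarith))
  have s1 : h x ≤ segMean h x y := by
    rw [← segMean_zero h x]; exact (strictMono_segMean hmono hc x).monotone hy.le
  have s2 : segMean h x (-y) ≤ h x := by
    rw [← segMean_zero h x]; exact (strictMono_segMean hmono hc x).monotone (by linarith)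
  have u2 := segMean_le hm (θ := 1 / 2) (by norm_num) (by norm_num) x hy.le
  have u4 := segMean_le hm (θ := 1 / 4) (by norm_num) (by norm_num) x hy.le
  have l2 := le_segMean_neg hm (θ := 1 / 2) (by norm_num) (by norm_num) x hy.le
  have l4 := le_segMean_neg hm (θ := 1 / 4) (by norm_num) (by norm_num) x hy.le
  have v1 : h (x + y * (1 / 2)) < h (x + y) := hmono (by linarith)
  have v2 : h (x - y) < h (x - y * (1 / 2)) := hmono (by linarith)
  have v3 : h (x + y * (1 / 4)) < h (x + y) := hmono (by linarith)
  have v4 : h (x - y) < h (x - y * (1 / 4)) := hmono (by linarith)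
  have w1 : h (x - y * (1 / 4)) < h x := hmono (by linarith)
  have w2 : h x < h (x + y * (1 / 4)) := hmono (by linarith)
  rcases le_total (h x - h (x - y)) (h (x + y) - h x) with hba | hab
  · refine (dilatation_le_of_le (c := h (x + y * (1 / 2)) - h x)
      (M := h (x - y * (1 / 4)) - h (x - y)) (N := h (x + y * (1 / 2)) - h (x - y * (1 / 4)))
      hb hba (by linarith) (by linarith) (by linarith) (by linarith) (by linarith)
      (by linarith) (by linarith) (by linarith)).trans ?_
    gcongr
    · exact le_max_left _ _
    · refine le_trans ?_ (le_max_left _ _)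
      refine le_trans (le_of_eq ?_) (le_max_left _ _)
      rw [show x - y / 4 + 3 * y / 4 = x + y * (1 / 2) by ring,
        show x - y / 4 - 3 * y / 4 = x - y by ring, show x - y / 4 = x - y * (1 / 4) by ring]
  · have := dilatation_le_of_le (c := h x - h (x - y * (1 / 2)))
      (M := h (x + y) - h (x + y * (1 / 4))) (N := h (x + y * (1 / 4)) - h (x - y * (1 / 2)))
      (ξ := segMean h x (-y) - h (x - y)) (η := h (x + y) - segMean h x y)
      ha hab (by linarith) (by linarith) (by linarith) (by linarith) (by linarith)
      (by linarith) (by linarith) (by linarith)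
    refine le_trans (le_of_eq ?_) (this.trans ?_)
    · congr 1 <;> ring
    gcongr
    · exact le_max_right _ _
    · refine le_trans ?_ (le_max_right _ _)
      refine le_trans (le_of_eq ?_) (le_max_right _ _)
      rw [show x + y / 4 + 3 * y / 4 = x + y by ring,
        show x + y / 4 - 3 * y / 4 = x - y * (1 / 2) by ring,
        show x + y / 4 = x + y * (1 / 4) by ring]

end Dilatation

section Integrability

/-- The linear map `(x, y) ↦ (x + r y, 3 y / 4)` of the plane. -/
def shearContract (r : ℝ) : (ℝ × ℝ) →ₗ[ℝ] (ℝ × ℝ) where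
  toFun p := (p.1 + r * p.2, 3 * p.2 / 4)
  map_add' p p' := by ext <;> simp <;> ring
  map_smul' c p := by ext <;> simp <;> ring

theorem shearContract_apply (r : ℝ) (p : ℝ × ℝ) :
    shearContract r p = (p.1 + r * p.2, 3 * p.2 / 4) := rfl

theorem det_shearContract_ne_zero (r : ℝ) : LinearMap.det (shearContract r) ≠ 0 := by
  have hinj : Injective (shearContract r) := by
    intro p p' hpp
    simp only [shearContract_apply, Prod.mk.injEq] at hpp
    have h2 : p.2 = p'.2 := by linarith [hpp.2]
    have h1 := hpp.1
    rw [h2] at h1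
    exact Prod.ext (by linarith) h2
  exact (LinearEquiv.isUnit_det' (LinearEquiv.ofInjectiveEndo _ hinj)).ne_zero

theorem lintegral_comp_shearContract_lt_top {g : ℝ × ℝ → ENNReal} (hg : Measurable g) (r : ℝ)
    (hfin : ∫⁻ p in upperHP, g p < ⊤) : ∫⁻ p in upperHP, g (shearContract r p) < ⊤ := by
  have hT : Measurable (shearContract r) :=
    (LinearMap.continuous_of_finiteDimensional _).measurable
  have hS : MeasurableSet upperHP := measurableSet_lt measurable_const measurable_snd
  have hpre : shearContract r ⁻¹' upperHP = upperHP := by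
    ext p
    simp only [upperHP, mem_preimage, mem_ofPred_eq, shearContract_apply]
    constructor <;> intro hp <;> linarith
  rw [← lintegral_map hg hT, ← hpre, ← Measure.restrict_map hT hS,
    Measure.map_linearMap_addHaar_eq_smul_addHaar _ (det_shearContract_ne_zero r),
    Measure.restrict_smul, lintegral_smul_measure, smul_eq_mul]
  exact ENNReal.mul_lt_top ENNReal.ofReal_lt_top hfin

theorem sphDen_pos (p : ℝ × ℝ) : 0 < sphDen p := by unfold sphDen; positivity

theorem sphDen_le_shearContract {r : ℝ} (hr : |r| ≤ 1 / 4) (p : ℝ × ℝ) :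
    sphDen p ≤ 4 * sphDen (shearContract r p) := by
  obtain ⟨x, y⟩ := p
  have hr2 : r ^ 2 ≤ 1 / 16 := by
    have := sq_le_sq' (by linarith [abs_nonneg r]) hr
    rw [sq_abs] at this
    linarith
  have key : 1 + (x + r * y) ^ 2 + (3 * y / 4) ^ 2 ≤ 2 * (1 + x ^ 2 + y ^ 2) := by
    nlinarith [sq_nonneg (x - r * y), mul_le_mul_of_nonneg_right hr2 (sq_nonneg y)]
  simp only [sphDen, shearContract_apply]
  rw [mul_div_assoc', div_le_div_iff₀ (by positivity) (by positivity)]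
  have := pow_le_pow_left₀ (by positivity) key 2
  nlinarith

theorem measurable_distortion_density {h : ℝ → ℝ} (hh : Measurable h) (q : ℝ) :
    Measurable fun p : ℝ × ℝ =>
      ENNReal.ofReal (Real.exp (q * rhoDist h p.1 p.2) * sphDen p) := by
  unfold rhoDist sphDen
  fun_prop

theorem exp_dilatation_integrable {h : ℝ → ℝ} (hmono : StrictMono h) (hc : Continuous h)
    {K : ℝ → ℝ → ℝ}
    (hK : ∀ x y : ℝ, 0 < y → 1 ≤ K x y ∧ K x y + (K x y)⁻¹ = BAdil h x y) {q : ℝ} (hq : 0 < q)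
    (hint : ∫⁻ p in upperHP,
      ENNReal.ofReal (Real.exp (q * rhoDist h p.1 p.2) * sphDen p) < ⊤) :
    ∫⁻ w in upperHP, ENNReal.ofReal (Real.exp (q / 32 * K w.1 w.2) * sphDen w) < ⊤ := by
  set g : ℝ × ℝ → ENNReal := fun p =>
    ENNReal.ofReal (Real.exp (q * rhoDist h p.1 p.2) * sphDen p) with hgdef
  have hg : Measurable g := measurable_distortion_density hc.measurable q
  have hS : MeasurableSet upperHP := measurableSet_lt measurable_const measurable_snd
  have hT : ∀ r, Measurable (shearContract r) := fun r =>
    (LinearMap.continuous_of_finiteDimensional _).measurable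
  have hshear : ∀ (r : ℝ) (w : ℝ × ℝ), |r| ≤ 1 / 4 →
      ENNReal.ofReal (Real.exp (q * rhoDist h (shearContract r w).1 (shearContract r w).2)
        * sphDen w) ≤ 4 * g (shearContract r w) := fun r w hr => by
    rw [hgdef, show (4 : ENNReal) = ENNReal.ofReal 4 by simp,
      ← ENNReal.ofReal_mul (by norm_num)]
    refine ENNReal.ofReal_le_ofReal ?_
    have := mul_le_mul_of_nonneg_left (sphDen_le_shearContract hr w)
      (Real.exp_pos (q * rhoDist h (shearContract r w).1 (shearContract r w).2)).le
    linarith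
  have hbound : ∀ w ∈ upperHP, ENNReal.ofReal (Real.exp (q / 32 * K w.1 w.2) * sphDen w) ≤
      g w + (4 * g (shearContract (-(1 / 4)) w) + 4 * g (shearContract (1 / 4) w)) := by
    rintro ⟨x, y⟩ hy
    have hy : 0 < y := hy
    obtain ⟨h1, h2⟩ := hK x y hy
    have hKD : K x y ≤ BAdil h x y := by
      have : 0 ≤ (K x y)⁻¹ := inv_nonneg.2 (by linarith)
      linarith
    have hle := hKD.trans (BAdil_le_rhoDist hmono hc x hy)
    have hexp : ∀ ρ : ℝ, K x y ≤ 32 * ρ →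
        ENNReal.ofReal (Real.exp (q / 32 * K x y) * sphDen (x, y)) ≤
          ENNReal.ofReal (Real.exp (q * ρ) * sphDen (x, y)) := fun ρ hρ => by
      have := (sphDen_pos (x, y)).le
      have : q / 32 * K x y ≤ q * ρ := by nlinarith
      gcongr
    rcases max_choice (rhoDist h x y) (max (rhoDist h (x - y / 4) (3 * y / 4))
      (rhoDist h (x + y / 4) (3 * y / 4))) with e | e <;> rw [e] at hle
    · exact (hexp _ hle).trans le_self_add
    · refine le_trans ?_ le_add_self
      rcases max_choice (rhoDist h (x - y / 4) (3 * y / 4))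
        (rhoDist h (x + y / 4) (3 * y / 4)) with e' | e' <;> rw [e'] at hle
      · refine le_trans ?_ le_self_add
        refine le_trans (hexp _ hle) (le_trans (le_of_eq ?_)
          (hshear (-(1 / 4)) (x, y) (by rw [abs_neg]; norm_num [abs_of_pos])))
        simp only [shearContract_apply]
        rw [show x + -(1 / 4) * y = x - y / 4 by ring]
      · refine le_trans ?_ le_add_self
        refine le_trans (hexp _ hle) (le_trans (le_of_eq ?_)
          (hshear (1 / 4) (x, y) (by norm_num [abs_of_pos])))
        simp only [shearContract_apply]
        rw [show x + 1 / 4 * y = x + y / 4 by ring]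
  refine lt_of_le_of_lt (setLIntegral_mono' hS hbound) ?_
  have hgT : ∀ r, Measurable fun w => g (shearContract r w) := fun r => hg.comp (hT r)
  rw [lintegral_add_left hg, lintegral_add_left ((hgT _).const_mul _),
    lintegral_const_mul _ (hgT _), lintegral_const_mul _ (hgT _)]
  have hfin : ∀ r, 4 * ∫⁻ w in upperHP, g (shearContract r w) < ⊤ := fun r =>
    ENNReal.mul_lt_top (by simp) (lintegral_comp_shearContract_lt_top hg r hint)
  exact ENNReal.add_lt_top.2 ⟨hint, ENNReal.add_lt_top.2 ⟨hfin _, hfin _⟩⟩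

end Integrability

/-- If `h : ℝ → ℝ` is an increasing homeomorphism with
`∫_ℍ e^{q ρ_h} dσ < ∞` for some `q > 0`, then the Beurling–Ahlfors extension of `h` is a
homeomorphism of the closed upper half-plane extending `h`, and its quasiconformal
dilatation `K` satisfies `∫_ℍ e^{p K} dσ < ∞` for some `p > 0`. -/
theorem david_extension_line (h : ℝ → ℝ) (hmono : StrictMono h) (hsurj : Surjective h)
    (K : ℝ → ℝ → ℝ)
    (hK : ∀ x y : ℝ, 0 < y → 1 ≤ K x y ∧ K x y + (K x y)⁻¹ = BAdil h x y)
    (q : ℝ) (hq : 0 < q)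
    (hint : ∫⁻ p in upperHP,
      ENNReal.ofReal (Real.exp (q * rhoDist h p.1 p.2) * sphDen p) < ⊤) :
    (∃ E : upperHPc ≃ₜ upperHPc, ∀ p : upperHPc, (E p : ℝ × ℝ) = BAext h p) ∧
    (∀ x : ℝ, BAext h (x, 0) = (h x, 0)) ∧
    (∃ p : ℝ, 0 < p ∧
      ∫⁻ w in upperHP,
        ENNReal.ofReal (Real.exp (p * K w.1 w.2) * sphDen w) < ⊤) := by
  have hc : Continuous h := hmono.monotone.continuous_of_surjective hsurj
  exact ⟨exists_homeomorph_BAext hmono hsurj, fun x => by simp [BAext],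
    q / 32, by positivity, exp_dilatation_integrable hmono hc hK hq hint⟩
end
end

section
/- There exists a uniform constant C₀ > 0 such that the following holds. Let Φ : [0,∞) → [0,∞) be an increasing convex function and let h : S¹ → S¹ be an orientation-preserving homeomorphism such that ∫₀^{2π} ∫₀^{π/2} Φ(q ρ_h^c(θ,t)) dt dθ < ∞ for some q > 0. Then there exists an orientation-preserving homeomorphism H of the closed unit disk onto itself with H restricted to S¹ equal to h, such that H is continuously differentiable on the open unit disk 𝔻 with positive Jacobian determinant, and ∫_𝔻 Φ(q C₀⁻¹ K_H(x,y)) dx dy < ∞. -/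
open MeasureTheory Set Function Real

noncomputable section

/-- The length of the arc of the unit circle from `a` to `b` in the positive orientation:
the unique `s ∈ [0, 2π)` with `b = a·e^{is}`. -/
def arcLen (a b : Circle) : ℝ :=
  if 0 ≤ Complex.arg ((b : ℂ) / (a : ℂ)) then Complex.arg ((b : ℂ) / (a : ℂ))
  else Complex.arg ((b : ℂ) / (a : ℂ)) + 2 * π

/-- The circular symmetric distortion function of a circle homeomorphism `h`. -/
def rhoCirc (h : Circle → Circle) (θ t : ℝ) : ℝ :=
  max (arcLen (h (Circle.exp θ)) (h (Circle.exp (θ + t))) /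
        arcLen (h (Circle.exp (θ - t))) (h (Circle.exp θ)))
      (arcLen (h (Circle.exp (θ - t))) (h (Circle.exp θ)) /
        arcLen (h (Circle.exp θ)) (h (Circle.exp (θ + t))))

/-- `h : S¹ → S¹` is an orientation-preserving homeomorphism: it lifts to an increasing
homeomorphism of `ℝ` commuting with the translation `x ↦ x + 2π`. -/
def IsOrientationPresHomeo (h : Circle → Circle) : Prop :=
  ∃ g : ℝ → ℝ, StrictMono g ∧ Continuous g ∧ Surjective g ∧
    (∀ θ : ℝ, g (θ + 2 * π) = g θ + 2 * π) ∧
    ∀ θ : ℝ, h (Circle.exp θ) = Circle.exp (g θ)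

/-- The quasiconformal dilatation `‖DH‖²/J_H` of a map `H : ℂ → ℂ` at the point `z`. -/
def dilC (H : ℂ → ℂ) (z : ℂ) : ℝ :=
  ‖fderiv ℝ H z‖ ^ 2 / (fderiv ℝ H z).det

/-! ### Averages of a function over segments -/

/-- The mean value of `g` over the segment with endpoints `x` and `x + y`. -/
def segAvg (g : ℝ → ℝ) (x y : ℝ) : ℝ := ∫ s in (0 : ℝ)..1, g (x + y * s)

/-- The partial derivative of `segAvg g` in its first variable. -/
def segAvgX (g : ℝ → ℝ) (x y : ℝ) : ℝ := (g (x + y) - g x) / y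

/-- The partial derivative of `segAvg g` in its second variable. -/
def segAvgY (g : ℝ → ℝ) (x y : ℝ) : ℝ := (g (x + y) - segAvg g x y) / y

section SegAvg

variable {g : ℝ → ℝ}

lemma segAvg_zero (g : ℝ → ℝ) (x : ℝ) : segAvg g x 0 = g x := by simp [segAvg]

lemma continuous_segAvg (hg : Continuous g) :
    Continuous fun p : ℝ × ℝ => segAvg g p.1 p.2 := by
  unfold segAvg
  apply intervalIntegral.continuous_parametric_intervalIntegral_of_continuous'
  unfold Function.uncurry
  fun_prop

lemma segAvg_eq_div (g : ℝ → ℝ) (x : ℝ) {y : ℝ} (hy : y ≠ 0) :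
    segAvg g x y = (∫ s in x..x + y, g s) / y := by
  unfold segAvg
  rw [intervalIntegral.integral_comp_add_mul _ hy]
  simp [div_eq_inv_mul]

lemma strictMono_segAvg_left (hg : StrictMono g) (hc : Continuous g) (y : ℝ) :
    StrictMono fun x => segAvg g x y := by
  intro a b hab
  refine intervalIntegral.integral_lt_integral_of_continuousOn_of_le_of_exists_lt one_pos
    (by fun_prop) (by fun_prop) (fun s _ => hg.monotone (by linarith))
    ⟨1, by simp, hg (by linarith)⟩

lemma strictMono_segAvg_right (hg : StrictMono g) (hc : Continuous g) (x : ℝ) :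
    StrictMono (segAvg g x) := by
  intro a b hab
  refine intervalIntegral.integral_lt_integral_of_continuousOn_of_le_of_exists_lt one_pos
    (by fun_prop) (by fun_prop) (fun s hs => hg.monotone ?_) ⟨1, by simp, hg (by linarith)⟩
  nlinarith [hs.1]

lemma segAvg_add_period {T : ℝ} (hc : Continuous g) (hT : ∀ x, g (x + T) = g x + T) (x y : ℝ) :
    segAvg g (x + T) y = segAvg g x y + T := by
  have : ∀ s, g (x + T + y * s) = g (x + y * s) + T := fun s => by rw [← hT]; ring_nf
  simp only [segAvg, this]
  rw [intervalIntegral.integral_add (Continuous.intervalIntegrable (by fun_prop) _ _) (by simp)]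
  simp

lemma hasFDerivAt_segAvg (hc : Continuous g) (z : ℂ) (hz : z.im ≠ 0) :
    HasFDerivAt (fun w : ℂ => segAvg g w.re w.im)
      (segAvgX g z.re z.im • Complex.reCLM + segAvgY g z.re z.im • Complex.imCLM) z := by
  have hG : ∀ x, HasDerivAt (fun u => ∫ s in (0 : ℝ)..u, g s) (g x) x := fun x =>
    intervalIntegral.integral_hasDerivAt_right (hc.intervalIntegrable _ _)
      (hc.stronglyMeasurableAtFilter _ _) hc.continuousAt
  have hre : HasFDerivAt (fun w : ℂ => w.re) Complex.reCLM z := Complex.reCLM.hasFDerivAt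
  have him : HasFDerivAt (fun w : ℂ => w.im) Complex.imCLM z := Complex.imCLM.hasFDerivAt
  have h1 := (hG (z.re + z.im)).comp_hasFDerivAt z (hre.add him)
  have h2 := (hG z.re).comp_hasFDerivAt z hre
  have h3 := (h1.sub h2).mul ((hasDerivAt_inv hz).comp_hasFDerivAt z him)
  have hev : (fun w : ℂ => segAvg g w.re w.im) =ᶠ[nhds z] fun w : ℂ =>
      ((∫ s in (0 : ℝ)..(w.re + w.im), g s) - ∫ s in (0 : ℝ)..w.re, g s) * (w.im)⁻¹ := by
    filter_upwards [Complex.continuous_im.continuousAt.eventually_ne hz] with w hw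
    rw [segAvg_eq_div _ _ hw, intervalIntegral.integral_interval_sub_left
      (hc.intervalIntegrable _ _) (hc.intervalIntegrable _ _), div_eq_mul_inv]
  refine (h3.congr_of_eventuallyEq hev).congr_fderiv ?_
  have hz' := hev.self_of_nhds
  ext v
  simp only [segAvgX, segAvgY, hz']
  simp
  field_simp
  ring

end SegAvg

/-! ### Real-linear maps of the plane given by their columns -/

/-- The real-linear map of the plane sending `1` to `p` and `I` to `q`. -/
def colMap (p q : ℂ) : ℂ →L[ℝ] ℂ :=
  Complex.reCLM.smulRight p + Complex.imCLM.smulRight q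

lemma colMap_apply (p q v : ℂ) : colMap p q v = v.re • p + v.im • q := by simp [colMap]

lemma continuous_colMap : Continuous fun r : ℂ × ℂ => colMap r.1 r.2 := by
  unfold colMap
  have h : ∀ L : ℂ →L[ℝ] ℝ, Continuous fun p : ℂ => L.smulRight p := fun L =>
    (ContinuousLinearMap.smulRightL ℝ ℂ ℂ L).continuous
  exact ((h _).comp continuous_fst).add ((h _).comp continuous_snd)

lemma det_eq_cols (L : ℂ →L[ℝ] ℂ) :
    L.det = (L 1).re * (L Complex.I).im - (L 1).im * (L Complex.I).re := by
  rw [ContinuousLinearMap.det, ← LinearMap.det_toMatrix Complex.basisOneI, Matrix.det_fin_two]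
  simp [LinearMap.toMatrix_apply]
  ring

lemma det_colMap (p q : ℂ) : (colMap p q).det = p.re * q.im - p.im * q.re := by
  simp [det_eq_cols, colMap_apply]

lemma norm_colMap_sq_le (p q : ℂ) : ‖colMap p q‖ ^ 2 ≤ ‖p‖ ^ 2 + ‖q‖ ^ 2 := by
  have h : ‖colMap p q‖ ≤ √(‖p‖ ^ 2 + ‖q‖ ^ 2) := by
    refine ContinuousLinearMap.opNorm_le_bound _ (Real.sqrt_nonneg _) fun v => ?_
    rw [colMap_apply]
    refine (norm_add_le _ _).trans ?_
    rw [norm_smul, norm_smul]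
    refine Real.le_sqrt_of_sq_le ?_ |>.trans_eq (?_ : √((‖p‖ ^ 2 + ‖q‖ ^ 2) * ‖v‖ ^ 2) = _)
    · have hv : ‖v‖ ^ 2 = ‖v.re‖ ^ 2 + ‖v.im‖ ^ 2 := by
        rw [Complex.sq_norm, Complex.normSq_apply, Real.norm_eq_abs, Real.norm_eq_abs, sq_abs,
          sq_abs]
        ring
      rw [hv]
      nlinarith [sq_nonneg (‖v.re‖ * ‖q‖ - ‖v.im‖ * ‖p‖)]
    · rw [Real.sqrt_mul (by positivity), Real.sqrt_sq (norm_nonneg _)]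
  calc ‖colMap p q‖ ^ 2 ≤ √(‖p‖ ^ 2 + ‖q‖ ^ 2) ^ 2 := by gcongr
    _ = _ := Real.sq_sqrt (by positivity)

/-! ### The Beurling–Ahlfors extension -/

/-- The Beurling–Ahlfors extension of `g`, normalized so that it fixes the identity. -/
def baExt (g : ℝ → ℝ) (z : ℂ) : ℂ :=
  ⟨(segAvg g z.re z.im + segAvg g z.re (-z.im)) / 2,
    segAvg g z.re z.im - segAvg g z.re (-z.im)⟩

/-- The partial derivative of `baExt g` in the real direction. -/
def baExtX (g : ℝ → ℝ) (z : ℂ) : ℂ :=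
  ⟨(segAvgX g z.re z.im + segAvgX g z.re (-z.im)) / 2,
    segAvgX g z.re z.im - segAvgX g z.re (-z.im)⟩

/-- The partial derivative of `baExt g` in the imaginary direction. -/
def baExtY (g : ℝ → ℝ) (z : ℂ) : ℂ :=
  ⟨(segAvgY g z.re z.im - segAvgY g z.re (-z.im)) / 2,
    segAvgY g z.re z.im + segAvgY g z.re (-z.im)⟩

/-- The symmetric distortion function of a homeomorphism of the line. -/
def rhoLine (g : ℝ → ℝ) (x t : ℝ) : ℝ :=
  max ((g (x + t) - g x) / (g x - g (x - t))) ((g x - g (x - t)) / (g (x + t) - g x))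

lemma continuous_complex_mk {X : Type*} [TopologicalSpace X] {f₁ f₂ : X → ℝ}
    (h₁ : Continuous f₁) (h₂ : Continuous f₂) : Continuous fun x => (⟨f₁ x, f₂ x⟩ : ℂ) :=
  Complex.equivRealProdCLM.symm.continuous.comp (h₁.prodMk h₂)

lemma continuousOn_complex_mk {X : Type*} [TopologicalSpace X] {f₁ f₂ : X → ℝ} {s : Set X}
    (h₁ : ContinuousOn f₁ s) (h₂ : ContinuousOn f₂ s) :
    ContinuousOn (fun x => (⟨f₁ x, f₂ x⟩ : ℂ)) s :=
  Complex.equivRealProdCLM.symm.continuous.comp_continuousOn (h₁.prodMk h₂)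

section BeurlingAhlfors

variable {g : ℝ → ℝ}

lemma continuous_segAvg_comp {X : Type*} [TopologicalSpace X] (hg : Continuous g) {f₁ f₂ : X → ℝ}
    (h₁ : Continuous f₁) (h₂ : Continuous f₂) : Continuous fun x => segAvg g (f₁ x) (f₂ x) :=
  (continuous_segAvg hg).comp (h₁.prodMk h₂)

lemma continuous_baExt (hg : Continuous g) : Continuous (baExt g) := by
  have h₁ := continuous_segAvg_comp hg Complex.continuous_re Complex.continuous_im
  have h₂ := continuous_segAvg_comp hg Complex.continuous_re Complex.continuous_im.neg
  exact continuous_complex_mk ((h₁.add h₂).div_const 2) (h₁.sub h₂)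

lemma baExt_ofReal (g : ℝ → ℝ) (x : ℝ) : baExt g x = g x := by
  apply Complex.ext <;> simp [baExt, segAvg_zero]

lemma baExt_add_period {T : ℝ} (hc : Continuous g) (hT : ∀ x, g (x + T) = g x + T) (z : ℂ) :
    baExt g (z + T) = baExt g z + T := by
  apply Complex.ext
  · simp [baExt, segAvg_add_period hc hT]
    ring
  · simp [baExt, segAvg_add_period hc hT]

lemma baExt_add_int_period {T : ℝ} (hc : Continuous g) (hT : ∀ x, g (x + T) = g x + T) (z : ℂ)
    (n : ℤ) : baExt g (z + n * T) = baExt g z + n * T := by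
  induction n with
  | zero => simp
  | succ n ih =>
    have := baExt_add_period hc hT (z + n * T)
    push_cast at ih ⊢
    rw [add_mul, one_mul, ← add_assoc, this, ih]
    ring
  | pred n ih =>
    have := baExt_add_period hc hT (z + (-n - 1) * T)
    push_cast at ih ⊢
    have e : z + (-n - 1) * (T : ℂ) + T = z + -n * T := by ring
    rw [e, ih] at this
    linear_combination -this

lemma baExt_im_pos (hg : StrictMono g) (hc : Continuous g) {z : ℂ} (hz : 0 < z.im) :
    0 < (baExt g z).im :=
  sub_pos.2 (strictMono_segAvg_right hg hc _ (by linarith))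

lemma injective_baExt (hg : StrictMono g) (hc : Continuous g) : Injective (baExt g) := by
  have key : ∀ z w : ℂ, segAvg g z.re z.im = segAvg g w.re w.im →
      segAvg g z.re (-z.im) = segAvg g w.re (-w.im) → ¬ z.re < w.re := by
    intro z w h₁ h₂ hlt
    have e₁ : w.im < z.im := (strictMono_segAvg_right hg hc w.re).lt_iff_lt.1
      (h₁ ▸ strictMono_segAvg_left hg hc z.im hlt)
    have e₂ : -w.im < -z.im := (strictMono_segAvg_right hg hc w.re).lt_iff_lt.1
      (h₂ ▸ strictMono_segAvg_left hg hc (-z.im) hlt)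
    linarith
  intro z w h
  have hre := congrArg Complex.re h
  have him := congrArg Complex.im h
  simp only [baExt] at hre him
  have h₁ : segAvg g z.re z.im = segAvg g w.re w.im := by linarith
  have h₂ : segAvg g z.re (-z.im) = segAvg g w.re (-w.im) := by linarith
  have hx : z.re = w.re :=
    le_antisymm (not_lt.1 (key w z h₁.symm h₂.symm)) (not_lt.1 (key z w h₁ h₂))
  rw [hx] at h₁
  exact Complex.ext hx ((strictMono_segAvg_right hg hc _).injective h₁)

lemma hasFDerivAt_baExt (hc : Continuous g) {z : ℂ} (hz : z.im ≠ 0) :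
    HasFDerivAt (baExt g) (colMap (baExtX g z) (baExtY g z)) z := by
  have h₁ := hasFDerivAt_segAvg hc z hz
  have h₂ := (hasFDerivAt_segAvg hc (starRingEnd ℂ z) (by simpa using hz)).comp z
    Complex.conjCLE.toContinuousLinearMap.hasFDerivAt
  have h₃ := (Complex.equivRealProdCLM.symm.toContinuousLinearMap.hasFDerivAt).comp z
    (((h₁.add h₂).mul_const (2⁻¹ : ℝ)).prodMk (h₁.sub h₂))
  refine (h₃.congr_of_eventuallyEq (.of_forall fun w => ?_)).congr_fderiv ?_
  · apply Complex.ext <;> simp [baExt, div_eq_mul_inv]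
  · refine ContinuousLinearMap.ext fun v => Complex.ext ?_ ?_
    · simp [colMap_apply, baExtX, baExtY, Complex.equivRealProdCLM_symm_apply]
      ring
    · simp [colMap_apply, baExtX, baExtY, Complex.equivRealProdCLM_symm_apply]
      ring

lemma fderiv_baExt (hc : Continuous g) {z : ℂ} (hz : z.im ≠ 0) :
    fderiv ℝ (baExt g) z = colMap (baExtX g z) (baExtY g z) :=
  (hasFDerivAt_baExt hc hz).fderiv

lemma continuousOn_segAvgX (hc : Continuous g) :
    ContinuousOn (fun p : ℝ × ℝ => segAvgX g p.1 p.2) {p | p.2 ≠ 0} :=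
  ContinuousOn.div (by fun_prop) continuousOn_snd fun _ hp => hp

lemma continuousOn_segAvgY (hc : Continuous g) :
    ContinuousOn (fun p : ℝ × ℝ => segAvgY g p.1 p.2) {p | p.2 ≠ 0} :=
  ContinuousOn.div
    ((hc.comp (continuous_fst.add continuous_snd)).sub (continuous_segAvg hc)).continuousOn
    continuousOn_snd fun _ hp => hp

lemma continuousOn_comp_re_im {f : ℝ → ℝ → ℝ}
    (hf : ContinuousOn (fun p : ℝ × ℝ => f p.1 p.2) {p | p.2 ≠ 0}) :
    ContinuousOn (fun z : ℂ => f z.re z.im) {z : ℂ | 0 < z.im} :=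
  hf.comp (f := fun z : ℂ => (z.re, z.im))
    (Complex.continuous_re.prodMk Complex.continuous_im).continuousOn fun _ hz => ne_of_gt hz

lemma continuousOn_comp_re_neg_im {f : ℝ → ℝ → ℝ}
    (hf : ContinuousOn (fun p : ℝ × ℝ => f p.1 p.2) {p | p.2 ≠ 0}) :
    ContinuousOn (fun z : ℂ => f z.re (-z.im)) {z : ℂ | 0 < z.im} :=
  hf.comp (f := fun z : ℂ => (z.re, -z.im))
    (Complex.continuous_re.prodMk Complex.continuous_im.neg).continuousOn
    fun _ hz => neg_ne_zero.2 (ne_of_gt hz)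

lemma continuousOn_baExtX (hc : Continuous g) : ContinuousOn (baExtX g) {z : ℂ | 0 < z.im} := by
  have h₁ := continuousOn_comp_re_im (continuousOn_segAvgX hc)
  have h₂ := continuousOn_comp_re_neg_im (continuousOn_segAvgX hc)
  exact continuousOn_complex_mk ((h₁.add h₂).div_const 2) (h₁.sub h₂)

lemma continuousOn_baExtY (hc : Continuous g) : ContinuousOn (baExtY g) {z : ℂ | 0 < z.im} := by
  have h₁ := continuousOn_comp_re_im (continuousOn_segAvgY hc)
  have h₂ := continuousOn_comp_re_neg_im (continuousOn_segAvgY hc)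
  exact continuousOn_complex_mk ((h₁.sub h₂).div_const 2) (h₁.add h₂)

lemma continuousOn_fderiv_baExt (hc : Continuous g) :
    ContinuousOn (fderiv ℝ (baExt g)) {z : ℂ | 0 < z.im} := by
  have h := continuous_colMap.comp_continuousOn
    ((continuousOn_baExtX hc).prodMk (continuousOn_baExtY hc))
  exact h.congr fun z hz => fderiv_baExt hc (ne_of_gt hz)

lemma contDiffOn_baExt (hc : Continuous g) :
    ContDiffOn ℝ 1 (baExt g) {z : ℂ | 0 < z.im} := by
  have ho : IsOpen {z : ℂ | 0 < z.im} := isOpen_lt continuous_const Complex.continuous_im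
  rw [show (1 : WithTop ℕ∞) = 0 + 1 by simp, contDiffOn_succ_iff_fderiv_of_isOpen ho,
    contDiffOn_zero]
  exact ⟨fun z hz =>
    (hasFDerivAt_baExt hc (ne_of_gt hz)).differentiableAt.differentiableWithinAt,
    by simp, continuousOn_fderiv_baExt hc⟩

/-! ### The dilatation of the Beurling–Ahlfors extension -/

lemma integral_le_of_monotone {f : ℝ → ℝ} (hf : MonotoneOn f (Icc 0 1)) (hc : Continuous f) {c : ℝ}
    (h₀ : 0 ≤ c) (h₁ : c ≤ 1) : ∫ s in (0 : ℝ)..1, f s ≤ c * f c + (1 - c) * f 1 := by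
  rw [← intervalIntegral.integral_add_adjacent_intervals (hc.intervalIntegrable 0 c)
    (hc.intervalIntegrable c 1)]
  have e₁ : ∫ s in (0 : ℝ)..c, f s ≤ ∫ _ in (0 : ℝ)..c, f c :=
    intervalIntegral.integral_mono_on h₀ (hc.intervalIntegrable _ _) (by simp)
      fun s hs => hf ⟨hs.1, hs.2.trans h₁⟩ ⟨h₀, h₁⟩ hs.2
  have e₂ : ∫ s in c..1, f s ≤ ∫ _ in c..1, f 1 :=
    intervalIntegral.integral_mono_on h₁ (hc.intervalIntegrable _ _) (by simp)
      fun s hs => hf ⟨h₀.trans hs.1, hs.2⟩ ⟨zero_le_one, le_rfl⟩ hs.2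
  simp only [intervalIntegral.integral_const, smul_eq_mul, sub_zero] at e₁ e₂
  linarith

lemma segAvg_le (hg : Monotone g) (hc : Continuous g) (x : ℝ) {y c : ℝ} (hy : 0 ≤ y)
    (h₀ : 0 ≤ c) (h₁ : c ≤ 1) :
    segAvg g x y ≤ c * g (x + y * c) + (1 - c) * g (x + y) := by
  have := integral_le_of_monotone (f := fun s => g (x + y * s))
    (fun s _ t _ hst => hg (by nlinarith)) (by fun_prop) h₀ h₁
  simpa [segAvg] using this

lemma le_segAvg_neg (hg : Monotone g) (hc : Continuous g) (x : ℝ) {y c : ℝ} (hy : 0 ≤ y)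
    (h₀ : 0 ≤ c) (h₁ : c ≤ 1) :
    c * g (x - y * c) + (1 - c) * g (x - y) ≤ segAvg g x (-y) := by
  have := integral_le_of_monotone (f := fun s => -g (x + -y * s))
    (fun s _ t _ hst => neg_le_neg (hg (by nlinarith))) (by fun_prop) h₀ h₁
  rw [intervalIntegral.integral_neg] at this
  simp only [segAvg, sub_eq_add_neg x, ← neg_mul]
  simp only [mul_one] at this
  linarith

lemma rhoLine_bounds (hg : StrictMono g) {x t : ℝ} (ht : 0 < t) {R : ℝ} (hR : rhoLine g x t ≤ R) :
    g (x + t) - g x ≤ R * (g x - g (x - t)) ∧ g x - g (x - t) ≤ R * (g (x + t) - g x) := by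
  have h₁ : 0 < g (x + t) - g x := sub_pos.2 (hg (by linarith))
  have h₂ : 0 < g x - g (x - t) := sub_pos.2 (hg (by linarith))
  exact ⟨(div_le_iff₀ h₂).1 ((le_max_left _ _).trans hR),
    (div_le_iff₀ h₁).1 ((le_max_right _ _).trans hR)⟩

lemma det_fderiv_baExt (hc : Continuous g) {z : ℂ} (hz : z.im ≠ 0) :
    (fderiv ℝ (baExt g) z).det =
      ((g (z.re + z.im) - g z.re) * (segAvg g z.re (-z.im) - g (z.re - z.im)) +
        (g z.re - g (z.re - z.im)) * (g (z.re + z.im) - segAvg g z.re z.im)) / z.im ^ 2 := by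
  rw [fderiv_baExt hc hz, det_colMap]
  simp only [baExtX, baExtY, segAvgX, segAvgY, sub_eq_add_neg z.re]
  field_simp
  ring

lemma segAvg_lt (hg : StrictMono g) (hc : Continuous g) (x : ℝ) {y : ℝ} (hy : 0 < y) :
    segAvg g x y < g (x + y) := by
  have := segAvg_le hg.monotone hc x hy.le (c := 1 / 2) (by norm_num) (by norm_num)
  have : g (x + y * (1 / 2)) < g (x + y) := hg (by linarith)
  linarith

lemma lt_segAvg_neg (hg : StrictMono g) (hc : Continuous g) (x : ℝ) {y : ℝ} (hy : 0 < y) :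
    g (x - y) < segAvg g x (-y) := by
  have := le_segAvg_neg hg.monotone hc x hy.le (c := 1 / 2) (by norm_num) (by norm_num)
  have : g (x - y) < g (x - y * (1 / 2)) := hg (by linarith)
  linarith

lemma det_fderiv_baExt_pos (hg : StrictMono g) (hc : Continuous g) {z : ℂ} (hz : 0 < z.im) :
    0 < (fderiv ℝ (baExt g) z).det := by
  rw [det_fderiv_baExt hc hz.ne']
  have h₁ := sub_pos.2 (segAvg_lt hg hc z.re hz)
  have h₂ := sub_pos.2 (lt_segAvg_neg hg hc z.re hz)
  have h₃ : 0 < g (z.re + z.im) - g z.re := sub_pos.2 (hg (by linarith))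
  have h₄ : 0 < g z.re - g (z.re - z.im) := sub_pos.2 (hg (by linarith))
  positivity

lemma ba_quadratic_bound_of_le {a b a' b' R : ℝ} (ha : 0 < a) (ha' : 0 < a') (hb : 0 < b)
    (hb' : 0 < b') (hR : 0 < R) (hle : b ≤ a) (hab : a ≤ R * b)
    (h : a ≤ 4 * a' ∨ a ≤ 8 * (R * b')) :
    5 / 2 * (a + b) ^ 2 ≤ 80 * R * (a * b' + b * a') := by
  have h4 : 5 / 2 * (a + b) ^ 2 ≤ 10 * (a * a) := by nlinarith
  have p₁ : 0 < R * (a * b') := by positivity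
  have p₂ : 0 < R * (b * a') := by positivity
  rcases h with h | h
  · have q₁ : a * a ≤ a * (4 * a') := mul_le_mul_of_nonneg_left h ha.le
    have q₂ : a * a' ≤ R * b * a' := mul_le_mul_of_nonneg_right hab ha'.le
    linarith
  · have q₁ : a * a ≤ a * (8 * (R * b')) := mul_le_mul_of_nonneg_left h ha.le
    linarith

/-- The dilatation of the Beurling–Ahlfors extension is controlled linearly by the distortion of
the boundary map at three points. -/
lemma dilC_baExt_le (hg : StrictMono g) (hc : Continuous g) {x y : ℝ} (hy : 0 < y) {R : ℝ}
    (hR₀ : rhoLine g x y ≤ R) (hR₁ : rhoLine g (x - y / 4) (3 / 4 * y) ≤ R)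
    (hR₂ : rhoLine g (x + y / 4) (3 / 4 * y) ≤ R) : dilC (baExt g) ⟨x, y⟩ ≤ 80 * R := by
  have hdet := det_fderiv_baExt_pos hg hc (z := ⟨x, y⟩) hy
  rw [dilC, div_le_iff₀ hdet, det_fderiv_baExt hc hy.ne', fderiv_baExt hc hy.ne']
  refine (norm_colMap_sq_le _ _).trans ?_
  have A₁ := segAvg_le hg.monotone hc x hy.le (c := 1 / 2) (by norm_num) (by norm_num)
  have A₂ := segAvg_le hg.monotone hc x hy.le (c := 1 / 4) (by norm_num) (by norm_num)
  have B₁ := le_segAvg_neg hg.monotone hc x hy.le (c := 1 / 2) (by norm_num) (by norm_num)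
  have B₂ := le_segAvg_neg hg.monotone hc x hy.le (c := 1 / 4) (by norm_num) (by norm_num)
  have A₀ : g x ≤ segAvg g x y := by
    simpa [segAvg_zero] using (strictMono_segAvg_right hg hc x).monotone hy.le
  have B₀ : segAvg g x (-y) ≤ g x := by
    simpa [segAvg_zero] using (strictMono_segAvg_right hg hc x).monotone (neg_nonpos.2 hy.le)
  obtain ⟨r₁, r₂⟩ := rhoLine_bounds hg hy hR₀
  have s := (rhoLine_bounds hg (by positivity) hR₁).1
  have t := (rhoLine_bounds hg (by positivity) hR₂).2
  rw [show x - y / 4 + 3 / 4 * y = x + y * (1 / 2) by ring,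
    show x - y / 4 - 3 / 4 * y = x - y by ring, show x - y / 4 = x - y * (1 / 4) by ring] at s
  rw [show x + y / 4 + 3 / 4 * y = x + y by ring,
    show x + y / 4 - 3 / 4 * y = x - y * (1 / 2) by ring,
    show x + y / 4 = x + y * (1 / 4) by ring] at t
  have m₁ : g (x - y * (1 / 4)) ≤ g x := hg.monotone (by linarith)
  have m₂ : g x ≤ g (x + y * (1 / 4)) := hg.monotone (by linarith)
  have m₃ : g x < g (x + y) := hg (by linarith)
  have m₄ : g (x - y) < g x := hg (by linarith)
  have hA' := segAvg_lt hg hc x hy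
  have hB' := lt_segAvg_neg hg hc x hy
  simp only [Complex.sq_norm, Complex.normSq_mk, baExtX, baExtY, segAvgX, segAvgY,
    ← sub_eq_add_neg]
  generalize segAvg g x y = A at *
  generalize segAvg g x (-y) = B at *
  obtain ⟨a, ha⟩ : ∃ a, a = g (x + y) - g x := ⟨_, rfl⟩
  obtain ⟨b, hb⟩ : ∃ b, b = g x - g (x - y) := ⟨_, rfl⟩
  obtain ⟨a', ha'⟩ : ∃ a', a' = g (x + y) - A := ⟨_, rfl⟩
  obtain ⟨b', hb'⟩ : ∃ b', b' = B - g (x - y) := ⟨_, rfl⟩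
  have e₁ : g (x - y) - g x = -b := by linarith
  have e₂ : g (x - y) - B = -b' := by linarith
  rw [← ha, ← hb, ← ha', ← hb', e₁, e₂]
  have ha0 : 0 < a := by linarith
  have hb0 : 0 < b := by linarith
  have ha'0 : 0 < a' := by linarith
  have hb'0 : 0 < b' := by linarith
  have haa : a' ≤ a := by linarith
  have hbb : b' ≤ b := by linarith
  have hab : a ≤ R * b := by rw [ha, hb]; exact r₁
  have hba : b ≤ R * a := by rw [ha, hb]; exact r₂
  have hR : 0 < R := pos_of_mul_pos_left (ha0.trans_le hab) hb0.le
  have main : 5 / 2 * (a + b) ^ 2 ≤ 80 * R * (a * b' + b * a') := by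
    rcases le_total b a with hle | hle
    · refine ba_quadratic_bound_of_le ha0 ha'0 hb0 hb'0 hR hle hab ?_
      rcases le_total (a / 2) (g (x + y) - g (x + y * (1 / 2))) with h | h
      · left; linarith
      · right
        have : g (x - y * (1 / 4)) - g (x - y) ≤ 4 * b' := by linarith
        linarith [mul_le_mul_of_nonneg_left this hR.le]
    · rw [add_comm a, add_comm (a * b')]
      refine ba_quadratic_bound_of_le hb0 hb'0 ha0 ha'0 hR hle hba ?_
      rcases le_total (b / 2) (g (x - y * (1 / 2)) - g (x - y)) with h | h
      · left; linarith
      · right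
        have : g (x + y) - g (x + y * (1 / 4)) ≤ 4 * a' := by linarith
        linarith [mul_le_mul_of_nonneg_left this hR.le]
  have hs : ((a + b) / 2) ^ 2 + (a - b) ^ 2 + (((a' - b') / 2) ^ 2 + (a' + b') ^ 2) ≤
      5 / 2 * (a + b) ^ 2 := by
    have q₁ : (a' - b') ^ 2 ≤ (a + b) ^ 2 := sq_le_sq' (by linarith) (by linarith)
    have q₂ : (a' + b') ^ 2 ≤ (a + b) ^ 2 := sq_le_sq' (by linarith) (by linarith)
    have q₃ : (a - b) ^ 2 ≤ (a + b) ^ 2 := sq_le_sq' (by linarith) (by linarith)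
    linarith
  calc _ = (((a + b) / 2) ^ 2 + (a - b) ^ 2 + (((a' - b') / 2) ^ 2 + (a' + b') ^ 2)) / y ^ 2 := by
        field_simp
    _ ≤ 80 * R * (a * b' + b * a') / y ^ 2 := by gcongr; exact hs.trans main
    _ = _ := by ring

end BeurlingAhlfors

/-! ### Behaviour near infinity -/

section Periodic

variable {g : ℝ → ℝ} {T : ℝ}

lemma exists_segAvg_asymptotics (hc : Continuous g) (hT₀ : 0 < T)
    (hT : ∀ x, g (x + T) = g x + T) :
    ∃ c M : ℝ, 0 ≤ M ∧ (∀ x, |g x - x| ≤ M) ∧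
      ∀ x y, y ≠ 0 → |segAvg g x y - (x + y / 2) - c| ≤ M / |y| := by
  have hp : Function.Periodic (fun x => g x - x) T := fun x => by simp only [hT]; ring
  have hpc : Continuous fun x => g x - x := by fun_prop
  obtain ⟨c, hcdef⟩ : ∃ c, c = (∫ s in (0 : ℝ)..T, (g s - s)) / T := ⟨_, rfl⟩
  have hq : Function.Periodic (fun x => g x - x - c) T := fun x => by simp only [hT]; ring
  have hqc : Continuous fun x => g x - x - c := by fun_prop
  have hqi : ∀ a b : ℝ, IntervalIntegrable (fun x => g x - x - c) volume a b :=
    fun a b => hqc.intervalIntegrable a b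
  have hzero : ∫ s in (0 : ℝ)..0 + T, (g s - s - c) = 0 := by
    rw [zero_add, intervalIntegral.integral_sub (hpc.intervalIntegrable _ _) (by simp),
      intervalIntegral.integral_const, hcdef, smul_eq_mul, sub_zero, mul_div_cancel₀ _ hT₀.ne',
      sub_self]
  have hQ : Function.Periodic (fun u => ∫ s in (0 : ℝ)..u, (g s - s - c)) T := fun u => by
    have h₁ := hq.intervalIntegral_add_eq u 0
    rw [hzero] at h₁
    have h₂ := intervalIntegral.integral_add_adjacent_intervals (hqi 0 u) (hqi u (u + T))
    simp only
    rw [← h₂, h₁, add_zero]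
  have hQc : Continuous fun u => ∫ s in (0 : ℝ)..u, (g s - s - c) :=
    intervalIntegral.continuous_primitive (fun a b => hqi a b) 0
  obtain ⟨M₁, hM₁⟩ := isBounded_iff_forall_norm_le.1 (hp.isBounded_of_continuous hT₀.ne' hpc)
  obtain ⟨M₂, hM₂⟩ := isBounded_iff_forall_norm_le.1 (hQ.isBounded_of_continuous hT₀.ne' hQc)
  have hM₁' : ∀ x, |g x - x| ≤ M₁ := fun x => hM₁ _ ⟨x, rfl⟩
  have hM₂' : ∀ u, |∫ s in (0 : ℝ)..u, (g s - s - c)| ≤ M₂ := fun u => hM₂ _ ⟨u, rfl⟩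
  refine ⟨c, max M₁ (2 * M₂), le_max_of_le_left ((abs_nonneg _).trans (hM₁' 0)),
    fun x => (hM₁' x).trans (le_max_left _ _), fun x y hy => ?_⟩
  have key : segAvg g x y - (x + y / 2) - c =
      ((∫ s in (0 : ℝ)..(x + y), (g s - s - c)) - ∫ s in (0 : ℝ)..x, (g s - s - c)) / y := by
    rw [intervalIntegral.integral_interval_sub_left (hqi _ _) (hqi _ _),
      intervalIntegral.integral_sub (hpc.intervalIntegrable _ _) (by simp),
      intervalIntegral.integral_sub (hc.intervalIntegrable _ _)
        (continuous_id'.intervalIntegrable _ _),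
      segAvg_eq_div _ _ hy, integral_id, intervalIntegral.integral_const, smul_eq_mul]
    field_simp
    ring
  rw [key, abs_div]
  gcongr
  exact (abs_sub _ _).trans (by linarith [hM₂' (x + y), hM₂' x, le_max_right M₁ (2 * M₂)])

lemma exists_baExt_asymptotics (hc : Continuous g) (hT₀ : 0 < T)
    (hT : ∀ x, g (x + T) = g x + T) :
    ∃ c K : ℝ, ∀ z : ℂ, 1 ≤ z.im → ‖baExt g z - z - c‖ ≤ K / z.im ∧
      ‖baExtX g z - 1‖ ≤ K / z.im ∧ ‖baExtY g z - Complex.I‖ ≤ K / z.im := by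
  obtain ⟨c, M, hM, hg, hA⟩ := exists_segAvg_asymptotics hc hT₀ hT
  refine ⟨c, 8 * M + 4 * |c|, fun z hz => ?_⟩
  obtain ⟨x, y⟩ := z
  simp only at hz
  have hy : 0 < y := by linarith
  have hA₁ := hA x y hy.ne'
  have hA₂ := hA x (-y) (neg_ne_zero.2 hy.ne')
  rw [abs_neg] at hA₂
  rw [abs_of_pos hy] at hA₁ hA₂
  have hMy : M / y ≤ M := div_le_self hM hz
  have hg₀ := abs_le.1 (hg x)
  have hg₁ := abs_le.1 (hg (x + y))
  have hg₂ := abs_le.1 (hg (x + -y))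
  have hcc := abs_le.1 (le_refl |c|)
  have hA₁' := abs_le.1 hA₁
  have hA₂' := abs_le.1 hA₂
  have X₁ : |segAvgX g x y - 1| ≤ 2 * M / y := by
    rw [show segAvgX g x y - 1 = (g (x + y) - g x - y) / y by unfold segAvgX; field_simp, abs_div,
      abs_of_pos hy]
    gcongr
    exact abs_le.2 ⟨by linarith, by linarith⟩
  have X₂ : |segAvgX g x (-y) - 1| ≤ 2 * M / y := by
    rw [show segAvgX g x (-y) - 1 = -((g (x + -y) - g x + y) / y) by
      unfold segAvgX; field_simp; ring, abs_neg, abs_div, abs_of_pos hy]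
    gcongr
    exact abs_le.2 ⟨by linarith, by linarith⟩
  have Y₁ : |segAvgY g x y - 1 / 2| ≤ (2 * M + |c|) / y := by
    rw [show segAvgY g x y - 1 / 2 = (g (x + y) - segAvg g x y - y / 2) / y by
      unfold segAvgY; field_simp, abs_div, abs_of_pos hy]
    gcongr
    exact abs_le.2 ⟨by linarith, by linarith⟩
  have Y₂ : |segAvgY g x (-y) - 1 / 2| ≤ (2 * M + |c|) / y := by
    rw [show segAvgY g x (-y) - 1 / 2 = -((g (x + -y) - segAvg g x (-y) + y / 2) / y) by
      unfold segAvgY; field_simp; ring, abs_neg, abs_div, abs_of_pos hy]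
    gcongr
    exact abs_le.2 ⟨by linarith, by linarith⟩
  have hcy : 0 ≤ |c| / y := by positivity
  have hMy0 : 0 ≤ M / y := by positivity
  have hX₁ := abs_le.1 X₁
  have hX₂ := abs_le.1 X₂
  have hY₁ := abs_le.1 Y₁
  have hY₂ := abs_le.1 Y₂
  rw [add_div, mul_div_assoc] at hY₁ hY₂
  rw [mul_div_assoc] at hX₁ hX₂
  rw [add_div, mul_div_assoc, mul_div_assoc]
  generalize M / y = m at *
  generalize |c| / y = d at *
  refine ⟨?_, ?_, ?_⟩
  · refine (Complex.norm_le_abs_re_add_abs_im _).trans ?_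
    have : |(segAvg g x y + segAvg g x (-y)) / 2 - x - c| ≤ m :=
      abs_le.2 ⟨by linarith, by linarith⟩
    have : |segAvg g x y - segAvg g x (-y) - y| ≤ 2 * m :=
      abs_le.2 ⟨by linarith, by linarith⟩
    simp [baExt]
    linarith
  · refine (Complex.norm_le_abs_re_add_abs_im _).trans ?_
    have : |(segAvgX g x y + segAvgX g x (-y)) / 2 - 1| ≤ 2 * m :=
      abs_le.2 ⟨by linarith, by linarith⟩
    have : |segAvgX g x y - segAvgX g x (-y)| ≤ 4 * m :=
      abs_le.2 ⟨by linarith, by linarith⟩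
    simp [baExtX]
    linarith
  · refine (Complex.norm_le_abs_re_add_abs_im _).trans ?_
    have : |(segAvgY g x y - segAvgY g x (-y)) / 2| ≤ 2 * m + d :=
      abs_le.2 ⟨by linarith, by linarith⟩
    have : |segAvgY g x y + segAvgY g x (-y) - 1| ≤ 4 * m + 2 * d :=
      abs_le.2 ⟨by linarith, by linarith⟩
    simp [baExtY]
    linarith

end Periodic

/-! ### The extension to the disk -/

/-- Multiplication by a complex number as a real-linear map. -/
abbrev mulMap (c : ℂ) : ℂ →L[ℝ] ℂ := ContinuousLinearMap.mul ℝ ℂ c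

lemma det_mulMap (c : ℂ) : (mulMap c).det = ‖c‖ ^ 2 := by
  rw [det_eq_cols, Complex.sq_norm, Complex.normSq_apply]
  simp

lemma det_comp (L M : ℂ →L[ℝ] ℂ) : (L.comp M).det = L.det * M.det := by
  simp only [ContinuousLinearMap.det]
  exact LinearMap.det_comp _ _

lemma HasDerivAt.hasFDerivAt_mulMap {f : ℂ → ℂ} {c z : ℂ} (h : HasDerivAt f c z) :
    HasFDerivAt f (mulMap c) z := by
  refine (h.hasFDerivAt.restrictScalars ℝ).congr_fderiv ?_
  ext
  simp [mul_comm]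

/-- The self-map of the disk induced, through the covering `z ↦ exp (I * z)` of the punctured disk
by the upper half-plane, by the Beurling–Ahlfors extension of `g`. -/
def diskExt (g : ℝ → ℝ) (w : ℂ) : ℂ :=
  if w = 0 then 0 else Complex.exp (Complex.I * baExt g (-Complex.I * Complex.log w))

/-- A point of the plane mapped to `w` by the covering `z ↦ exp (I * z)`. -/
def diskLift (w : ℂ) : ℂ := -Complex.I * Complex.log w

lemma exp_diskLift {w : ℂ} (hw : w ≠ 0) : Complex.exp (Complex.I * diskLift w) = w := by
  rw [diskLift, ← mul_assoc, mul_neg, Complex.I_mul_I, neg_neg, one_mul, Complex.exp_log hw]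

lemma diskLift_im (w : ℂ) : (diskLift w).im = -Real.log ‖w‖ := by
  simp [diskLift, Complex.log_re]

lemma diskLift_im_pos {w : ℂ} (hw : w ≠ 0) (h : ‖w‖ < 1) : 0 < (diskLift w).im := by
  rw [diskLift_im, neg_pos]
  exact Real.log_neg (norm_pos_iff.2 hw) h

section DiskExt

variable {g : ℝ → ℝ}

lemma diskExt_zero (g : ℝ → ℝ) : diskExt g 0 = 0 := by simp [diskExt]

lemma exp_I_mul_eq_iff {z w : ℂ} : Complex.exp (Complex.I * z) = Complex.exp (Complex.I * w) ↔
    ∃ n : ℤ, z = w + n * (2 * π : ℝ) := by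
  rw [Complex.exp_eq_exp_iff_exists_int]
  refine exists_congr fun n => ?_
  rw [← mul_right_inj' (b := z) Complex.I_ne_zero]
  push_cast
  ring_nf

lemma diskExt_exp (hc : Continuous g) (hT : ∀ x, g (x + 2 * π) = g x + 2 * π) (z : ℂ) :
    diskExt g (Complex.exp (Complex.I * z)) = Complex.exp (Complex.I * baExt g z) := by
  rw [diskExt, if_neg (Complex.exp_ne_zero _), exp_I_mul_eq_iff]
  obtain ⟨n, hn⟩ := exp_I_mul_eq_iff.1 (exp_diskLift (Complex.exp_ne_zero (Complex.I * z)))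
  rw [diskLift] at hn
  exact ⟨n, by rw [hn, baExt_add_int_period hc hT]⟩

lemma diskExt_circle (hc : Continuous g) (hT : ∀ x, g (x + 2 * π) = g x + 2 * π) (θ : ℝ) :
    diskExt g (Circle.exp θ) = Circle.exp (g θ) := by
  rw [Circle.coe_exp, mul_comm, diskExt_exp hc hT, baExt_ofReal, Circle.coe_exp, mul_comm]

lemma injective_diskExt (hg : StrictMono g) (hc : Continuous g)
    (hT : ∀ x, g (x + 2 * π) = g x + 2 * π) : Injective (diskExt g) := by
  intro w w' h
  by_cases hw : w = 0
  · by_cases hw' : w' = 0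
    · rw [hw, hw']
    · rw [hw, diskExt_zero, diskExt, if_neg hw'] at h
      exact absurd h.symm (Complex.exp_ne_zero _)
  · by_cases hw' : w' = 0
    · rw [hw', diskExt_zero, diskExt, if_neg hw] at h
      exact absurd h (Complex.exp_ne_zero _)
    · rw [← exp_diskLift hw, ← exp_diskLift hw', diskExt_exp hc hT, diskExt_exp hc hT,
        exp_I_mul_eq_iff] at h
      obtain ⟨n, hn⟩ := h
      rw [← baExt_add_int_period hc hT] at hn
      rw [← exp_diskLift hw, ← exp_diskLift hw', exp_I_mul_eq_iff]
      exact ⟨n, injective_baExt hg hc hn⟩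

lemma norm_diskExt_lt_one (hg : StrictMono g) (hc : Continuous g) {w : ℂ} (hw : ‖w‖ < 1) :
    ‖diskExt g w‖ < 1 := by
  by_cases h : w = 0
  · simp [h, diskExt_zero]
  · rw [diskExt, if_neg h, Complex.norm_exp, Real.exp_lt_one_iff]
    have := baExt_im_pos hg hc (diskLift_im_pos h hw)
    simpa [diskLift] using this

/-- A branch near `exp (I * z)` of the inverse of the covering. -/
def localLift (z w : ℂ) : ℂ := z - Complex.I * Complex.log (w / Complex.exp (Complex.I * z))

lemma exp_localLift (z : ℂ) {w : ℂ} (hw : w ≠ 0) :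
    Complex.exp (Complex.I * localLift z w) = w := by
  rw [localLift, mul_sub, ← mul_assoc, Complex.I_mul_I, neg_one_mul, sub_neg_eq_add,
    Complex.exp_add, Complex.exp_log (div_ne_zero hw (Complex.exp_ne_zero _)),
    mul_div_cancel₀ _ (Complex.exp_ne_zero _)]

lemma localLift_self (z : ℂ) : localLift z (Complex.exp (Complex.I * z)) = z := by
  simp [localLift]

lemma hasDerivAt_localLift (z : ℂ) :
    HasDerivAt (localLift z) (-Complex.I / Complex.exp (Complex.I * z))
      (Complex.exp (Complex.I * z)) := by
  have h₁ : HasDerivAt (fun w => w / Complex.exp (Complex.I * z))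
      (1 / Complex.exp (Complex.I * z)) (Complex.exp (Complex.I * z)) :=
    (hasDerivAt_id _).div_const _
  have h₂ := (h₁.clog (by simp [Complex.exp_ne_zero])).const_mul Complex.I |>.const_sub z
  refine h₂.congr_deriv ?_
  have := Complex.exp_ne_zero (Complex.I * z)
  field_simp

lemma contDiffAt_localLift (z : ℂ) :
    ContDiffAt ℝ 1 (localLift z) (Complex.exp (Complex.I * z)) := by
  have : ContDiffAt ℂ 1 (localLift z) (Complex.exp (Complex.I * z)) := by
    refine contDiffAt_const.sub (contDiffAt_const.mul ?_)
    exact (Complex.contDiffAt_log (by simp [Complex.exp_ne_zero])).comp _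
      (contDiffAt_id.div_const _)
  exact this.restrict_scalars ℝ

lemma diskExt_eventuallyEq (hc : Continuous g) (hT : ∀ x, g (x + 2 * π) = g x + 2 * π) (z : ℂ) :
    diskExt g =ᶠ[nhds (Complex.exp (Complex.I * z))]
      fun w => Complex.exp (Complex.I * baExt g (localLift z w)) := by
  filter_upwards [isOpen_ne.mem_nhds (Complex.exp_ne_zero (Complex.I * z))] with w hw
  rw [← diskExt_exp hc hT, exp_localLift z hw]

lemma continuousAt_diskExt (hc : Continuous g) (hT : ∀ x, g (x + 2 * π) = g x + 2 * π) {w : ℂ}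
    (hw : w ≠ 0) : ContinuousAt (diskExt g) w := by
  rw [← exp_diskLift hw]
  refine ContinuousAt.congr ?_ (diskExt_eventuallyEq hc hT (diskLift w)).symm
  exact Complex.continuous_exp.continuousAt.comp (continuousAt_const.mul
    ((continuous_baExt hc).continuousAt.comp (hasDerivAt_localLift _).continuousAt))

lemma contDiffAt_diskExt (hc : Continuous g) (hT : ∀ x, g (x + 2 * π) = g x + 2 * π) {w : ℂ}
    (hw : w ≠ 0) (h : ‖w‖ < 1) : ContDiffAt ℝ 1 (diskExt g) w := by
  have hz := diskLift_im_pos hw h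
  rw [← exp_diskLift hw]
  generalize diskLift w = z at *
  refine ContDiffAt.congr_of_eventuallyEq ?_ (diskExt_eventuallyEq hc hT z)
  have hb : ContDiffAt ℝ 1 (baExt g) (localLift z (Complex.exp (Complex.I * z))) := by
    rw [localLift_self]
    exact (contDiffOn_baExt hc).contDiffAt
      ((isOpen_lt continuous_const Complex.continuous_im).mem_nhds hz)
  exact (contDiffAt_const.mul (hb.comp _ (contDiffAt_localLift z))).cexp

lemma fderiv_diskExt_exp (hc : Continuous g) (hT : ∀ x, g (x + 2 * π) = g x + 2 * π) {z : ℂ}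
    (hz : 0 < z.im) : fderiv ℝ (diskExt g) (Complex.exp (Complex.I * z)) =
      (mulMap (Complex.I * Complex.exp (Complex.I * baExt g z))).comp
        ((fderiv ℝ (baExt g) z).comp (mulMap (-Complex.I / Complex.exp (Complex.I * z)))) := by
  have h₁ := (hasDerivAt_localLift z).hasFDerivAt_mulMap
  have h₂ : HasFDerivAt (baExt g) (fderiv ℝ (baExt g) z)
      (localLift z (Complex.exp (Complex.I * z))) := by
    rw [localLift_self]
    exact (hasFDerivAt_baExt hc hz.ne').differentiableAt.hasFDerivAt
  have h₃ : HasDerivAt (fun v => Complex.exp (Complex.I * v))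
      (Complex.I * Complex.exp (Complex.I * baExt g z))
      (baExt g (localLift z (Complex.exp (Complex.I * z)))) := by
    rw [localLift_self]
    refine (((hasDerivAt_id (baExt g z)).const_mul Complex.I).cexp).congr_deriv ?_
    simp [mul_comm]
  refine HasFDerivAt.fderiv ?_
  have h₄ := h₃.hasFDerivAt_mulMap.comp (Complex.exp (Complex.I * z)) (h₂.comp _ h₁)
  exact h₄.congr_of_eventuallyEq (diskExt_eventuallyEq hc hT z)

lemma det_fderiv_diskExt_pos_of_ne_zero (hg : StrictMono g) (hc : Continuous g)
    (hT : ∀ x, g (x + 2 * π) = g x + 2 * π) {w : ℂ} (hw : w ≠ 0) (h : ‖w‖ < 1) :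
    0 < (fderiv ℝ (diskExt g) w).det := by
  have hz := diskLift_im_pos hw h
  rw [← exp_diskLift hw, fderiv_diskExt_exp hc hT hz, det_comp, det_comp, det_mulMap, det_mulMap]
  have := det_fderiv_baExt_pos hg hc hz
  have h₁ : 0 < ‖Complex.I * Complex.exp (Complex.I * baExt g (diskLift w))‖ :=
    norm_pos_iff.2 (mul_ne_zero Complex.I_ne_zero (Complex.exp_ne_zero _))
  have h₂ : 0 < ‖-Complex.I / Complex.exp (Complex.I * diskLift w)‖ :=
    norm_pos_iff.2 (div_ne_zero (neg_ne_zero.2 Complex.I_ne_zero) (Complex.exp_ne_zero _))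
  positivity

lemma dilC_diskExt_exp_le (hg : StrictMono g) (hc : Continuous g)
    (hT : ∀ x, g (x + 2 * π) = g x + 2 * π) {z : ℂ} (hz : 0 < z.im) :
    dilC (diskExt g) (Complex.exp (Complex.I * z)) ≤ dilC (baExt g) z := by
  have hd := det_fderiv_baExt_pos hg hc hz
  have h₁ : 0 < ‖Complex.I * Complex.exp (Complex.I * baExt g z)‖ :=
    norm_pos_iff.2 (mul_ne_zero Complex.I_ne_zero (Complex.exp_ne_zero _))
  have h₂ : 0 < ‖-Complex.I / Complex.exp (Complex.I * z)‖ :=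
    norm_pos_iff.2 (div_ne_zero (neg_ne_zero.2 Complex.I_ne_zero) (Complex.exp_ne_zero _))
  rw [dilC, dilC, fderiv_diskExt_exp hc hT hz, det_comp, det_comp, det_mulMap, det_mulMap]
  generalize Complex.I * Complex.exp (Complex.I * baExt g z) = p at *
  generalize -Complex.I / Complex.exp (Complex.I * z) = r at *
  have hn : ‖(mulMap p).comp ((fderiv ℝ (baExt g) z).comp (mulMap r))‖ ≤
      ‖p‖ * (‖fderiv ℝ (baExt g) z‖ * ‖r‖) := by
    refine (ContinuousLinearMap.opNorm_comp_le _ _).trans ?_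
    rw [ContinuousLinearMap.opNorm_mul_apply]
    gcongr
    refine (ContinuousLinearMap.opNorm_comp_le _ _).trans ?_
    rw [ContinuousLinearMap.opNorm_mul_apply]
  rw [div_le_div_iff₀ (by positivity) hd]
  calc _ ≤ (‖p‖ * (‖fderiv ℝ (baExt g) z‖ * ‖r‖)) ^ 2 * (fderiv ℝ (baExt g) z).det := by gcongr
    _ = _ := by ring

lemma tendsto_diskLift_im :
    Filter.Tendsto (fun w => (diskLift w).im) (nhdsWithin 0 {0}ᶜ) Filter.atTop := by
  simp only [diskLift_im]
  exact Filter.tendsto_neg_atBot_atTop.comp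
    (Real.tendsto_log_nhdsNE_zero.comp (tendsto_norm_nhdsNE_zero.mono_right
      (nhdsWithin_mono _ fun x hx => ne_of_gt hx)))

/-- The disk extension is continuously differentiable and conformal at the origin. -/
lemma exists_deriv_diskExt_zero (hc : Continuous g) (hT : ∀ x, g (x + 2 * π) = g x + 2 * π) :
    ∃ p : ℂ, p ≠ 0 ∧ HasFDerivAt (diskExt g) (mulMap p) 0 ∧
      ContinuousAt (fderiv ℝ (diskExt g)) 0 := by
  obtain ⟨c, K, hcK⟩ := exists_baExt_asymptotics hc Real.two_pi_pos hT
  have him := tendsto_diskLift_im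
  have hsm : Filter.Tendsto (fun w => K / (diskLift w).im) (nhdsWithin 0 {0}ᶜ) (nhds 0) :=
    him.const_div_atTop K
  have hev : ∀ᶠ w in nhdsWithin (0 : ℂ) {0}ᶜ, w ≠ 0 ∧ 1 ≤ (diskLift w).im :=
    (eventually_mem_nhdsWithin).and (him.eventually_ge_atTop 1)
  have hB : Filter.Tendsto (fun w => baExt g (diskLift w) - diskLift w)
      (nhdsWithin 0 {0}ᶜ) (nhds (c : ℂ)) := by
    rw [tendsto_iff_norm_sub_tendsto_zero]
    exact squeeze_zero' (.of_forall fun _ => norm_nonneg _)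
      (hev.mono fun w hw => (hcK _ hw.2).1) hsm
  have hD : Filter.Tendsto (fun w => fderiv ℝ (baExt g) (diskLift w))
      (nhdsWithin 0 {0}ᶜ) (nhds (mulMap 1)) := by
    have hX : Filter.Tendsto (fun w => baExtX g (diskLift w))
        (nhdsWithin 0 {0}ᶜ) (nhds 1) := by
      rw [tendsto_iff_norm_sub_tendsto_zero]
      exact squeeze_zero' (.of_forall fun _ => norm_nonneg _)
        (hev.mono fun w hw => (hcK _ hw.2).2.1) hsm
    have hY : Filter.Tendsto (fun w => baExtY g (diskLift w))
        (nhdsWithin 0 {0}ᶜ) (nhds Complex.I) := by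
      rw [tendsto_iff_norm_sub_tendsto_zero]
      exact squeeze_zero' (.of_forall fun _ => norm_nonneg _)
        (hev.mono fun w hw => (hcK _ hw.2).2.2) hsm
    have h := (continuous_colMap.tendsto (1, Complex.I)).comp (hX.prodMk_nhds hY)
    have e : colMap 1 Complex.I = mulMap 1 := by ext; simp [colMap_apply]
    rw [e] at h
    refine h.congr' (hev.mono fun w hw => ?_)
    exact (fderiv_baExt hc (by linarith [hw.2])).symm
  have hE : Filter.Tendsto (fun w => diskExt g w / w) (nhdsWithin 0 {0}ᶜ)
      (nhds (Complex.exp (Complex.I * c))) := by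
    refine ((Complex.continuous_exp.tendsto _).comp (hB.const_mul Complex.I)).congr'
      (hev.mono fun w hw => ?_)
    rw [Function.comp_apply, mul_sub, Complex.exp_sub, exp_diskLift hw.1, ← diskExt_exp hc hT,
      exp_diskLift hw.1]
  have h0 : HasFDerivAt (diskExt g) (mulMap (Complex.exp (Complex.I * c))) 0 := by
    refine HasDerivAt.hasFDerivAt_mulMap (hasDerivAt_iff_tendsto_slope.2 (hE.congr fun w => ?_))
    simp [slope_def_field, diskExt_zero]
  refine ⟨_, Complex.exp_ne_zero _, h0, ?_⟩
  rw [← continuousWithinAt_compl_self, ContinuousWithinAt, h0.fderiv]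
  have hsplit : ∀ᶠ w in nhdsWithin (0 : ℂ) {0}ᶜ,
      mulMap (diskExt g w / w) + (mulMap (Complex.I * diskExt g w)).comp
        ((fderiv ℝ (baExt g) (diskLift w) - mulMap 1).comp (mulMap (-Complex.I / w))) =
      fderiv ℝ (diskExt g) w := by
    filter_upwards [hev] with w hw
    have h := fderiv_diskExt_exp hc hT (z := diskLift w) (by linarith [hw.2])
    rw [← diskExt_exp hc hT, exp_diskLift hw.1] at h
    rw [h]
    refine ContinuousLinearMap.ext fun v => ?_
    simp only [_root_.add_apply, ContinuousLinearMap.comp_apply,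
      _root_.sub_apply, ContinuousLinearMap.mul_apply']
    linear_combination (diskExt g w * v / w) * Complex.I_sq
  have hrest : Filter.Tendsto (fun w => (mulMap (Complex.I * diskExt g w)).comp
      ((fderiv ℝ (baExt g) (diskLift w) - mulMap 1).comp (mulMap (-Complex.I / w))))
      (nhdsWithin 0 {0}ᶜ) (nhds 0) := by
    have hlim := hE.norm.mul (tendsto_iff_norm_sub_tendsto_zero.1 hD)
    rw [mul_zero] at hlim
    refine squeeze_zero_norm (fun w => ?_) hlim
    refine (ContinuousLinearMap.opNorm_comp_le _ _).trans ?_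
    refine (mul_le_mul_of_nonneg_left (ContinuousLinearMap.opNorm_comp_le _ _)
      (norm_nonneg _)).trans_eq ?_
    rw [ContinuousLinearMap.opNorm_mul_apply, ContinuousLinearMap.opNorm_mul_apply]
    simp only [norm_mul, norm_div, norm_neg, Complex.norm_I]
    ring
  have hmain := (((ContinuousLinearMap.mul ℝ ℂ).continuous.tendsto _).comp hE).add hrest
  rw [add_zero] at hmain
  exact hmain.congr' hsplit

lemma det_fderiv_diskExt_pos (hg : StrictMono g) (hc : Continuous g)
    (hT : ∀ x, g (x + 2 * π) = g x + 2 * π) {w : ℂ} (h : ‖w‖ < 1) :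
    0 < (fderiv ℝ (diskExt g) w).det := by
  by_cases hw : w = 0
  · obtain ⟨p, hp, hd, -⟩ := exists_deriv_diskExt_zero hc hT
    rw [hw, hd.fderiv, det_mulMap]
    have := norm_pos_iff.2 hp
    positivity
  · exact det_fderiv_diskExt_pos_of_ne_zero hg hc hT hw h

lemma continuous_diskExt (hc : Continuous g) (hT : ∀ x, g (x + 2 * π) = g x + 2 * π) :
    Continuous (diskExt g) := by
  refine continuous_iff_continuousAt.2 fun w => ?_
  by_cases hw : w = 0
  · obtain ⟨p, -, hd, -⟩ := exists_deriv_diskExt_zero hc hT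
    rw [hw]
    exact hd.continuousAt
  · exact continuousAt_diskExt hc hT hw

lemma contDiffOn_diskExt (hc : Continuous g) (hT : ∀ x, g (x + 2 * π) = g x + 2 * π) :
    ContDiffOn ℝ 1 (diskExt g) (Metric.ball 0 1) := by
  obtain ⟨p, -, hd, hcont⟩ := exists_deriv_diskExt_zero hc hT
  rw [show (1 : WithTop ℕ∞) = 0 + 1 by simp,
    contDiffOn_succ_iff_fderiv_of_isOpen Metric.isOpen_ball, contDiffOn_zero]
  refine ⟨fun w hw => ?_, by simp, fun w hw => ?_⟩
  · by_cases h : w = 0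
    · rw [h]
      exact hd.differentiableAt.differentiableWithinAt
    · exact ((contDiffAt_diskExt hc hT h (mem_ball_zero_iff.1 hw)).differentiableAt
        one_ne_zero).differentiableWithinAt
  · by_cases h : w = 0
    · rw [h]
      exact hcont.continuousWithinAt
    · exact ((contDiffAt_diskExt hc hT h (mem_ball_zero_iff.1 hw)).continuousAt_fderiv
        one_ne_zero).continuousWithinAt

lemma isOpen_image_diskExt (hg : StrictMono g) (hc : Continuous g)
    (hT : ∀ x, g (x + 2 * π) = g x + 2 * π) : IsOpen (diskExt g '' Metric.ball 0 1) := by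
  rw [isOpen_iff_mem_nhds]
  rintro _ ⟨w, hw, rfl⟩
  have hs := ((contDiffOn_diskExt hc hT).contDiffAt
    (Metric.isOpen_ball.mem_nhds hw)).hasStrictFDerivAt one_ne_zero
  have hdet := det_fderiv_diskExt_pos hg hc hT (mem_ball_zero_iff.1 hw)
  have hsurj : (fderiv ℝ (diskExt g) w : ℂ →ₗ[ℝ] ℂ).range = ⊤ :=
    LinearMap.range_eq_top.2
      (LinearEquiv.ofIsUnitDet (f := (fderiv ℝ (diskExt g) w : ℂ →ₗ[ℝ] ℂ))
        (v := Complex.basisOneI) (v' := Complex.basisOneI)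
        (by rw [LinearMap.det_toMatrix]; exact isUnit_iff_ne_zero.2 hdet.ne')).surjective
  rw [← hs.map_nhds_eq_of_surj hsurj]
  exact Filter.image_mem_map (Metric.isOpen_ball.mem_nhds hw)

lemma exists_circle_exp {z : ℂ} (hz : ‖z‖ = 1) : ∃ θ : ℝ, z = Circle.exp θ :=
  ⟨Complex.arg z, by
    have := Complex.norm_mul_exp_arg_mul_I z
    rw [hz, Complex.ofReal_one, one_mul] at this
    rw [Circle.coe_exp, this]⟩

lemma image_diskExt (hg : StrictMono g) (hc : Continuous g) (hgs : Surjective g)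
    (hT : ∀ x, g (x + 2 * π) = g x + 2 * π) :
    diskExt g '' Metric.closedBall 0 1 = Metric.closedBall 0 1 := by
  have hsphere : ∀ w : ℂ, ‖w‖ = 1 → ‖diskExt g w‖ = 1 := fun w hw => by
    obtain ⟨θ, rfl⟩ := exists_circle_exp hw
    rw [diskExt_circle hc hT, Circle.norm_coe]
  apply Subset.antisymm
  · rintro _ ⟨w, hw, rfl⟩
    rw [mem_closedBall_zero_iff] at hw ⊢
    rcases hw.lt_or_eq with h | h
    · exact (norm_diskExt_lt_one hg hc h).le
    · exact (hsphere w h).le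
  · have hball : Metric.ball (0 : ℂ) 1 ⊆ diskExt g '' Metric.ball 0 1 := by
      refine (convex_ball (0 : ℂ) 1).isPreconnected.subset_of_closure_inter_subset
        (isOpen_image_diskExt hg hc hT)
        ⟨0, by simp, 0, by simp, diskExt_zero g⟩ ?_
      rintro y ⟨hy, hy₁⟩
      have hcl : closure (diskExt g '' Metric.ball 0 1) ⊆ diskExt g '' Metric.closedBall 0 1 :=
        closure_minimal (image_mono Metric.ball_subset_closedBall)
          ((isCompact_closedBall 0 1).image (continuous_diskExt hc hT)).isClosed
      obtain ⟨w, hw, rfl⟩ := hcl hy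
      rcases (mem_closedBall_zero_iff.1 hw).lt_or_eq with h | h
      · exact ⟨w, mem_ball_zero_iff.2 h, rfl⟩
      · rw [mem_ball_zero_iff, hsphere w h] at hy₁
        exact absurd hy₁ (lt_irrefl _)
    intro y hy
    rcases (mem_closedBall_zero_iff.1 hy).lt_or_eq with h | h
    · exact image_mono Metric.ball_subset_closedBall (hball (mem_ball_zero_iff.2 h))
    · obtain ⟨θ, rfl⟩ := exists_circle_exp h
      obtain ⟨t, rfl⟩ := hgs θ
      exact ⟨Circle.exp t, by simp, diskExt_circle hc hT t⟩

/-- The disk extension as a self-homeomorphism of the closed disk. -/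
lemma exists_homeomorph_diskExt (hg : StrictMono g) (hc : Continuous g) (hgs : Surjective g)
    (hT : ∀ x, g (x + 2 * π) = g x + 2 * π) :
    ∃ E : Metric.closedBall (0 : ℂ) 1 ≃ₜ Metric.closedBall (0 : ℂ) 1,
      ∀ p : Metric.closedBall (0 : ℂ) 1, (E p : ℂ) = diskExt g p := by
  have hbij : BijOn (diskExt g) (Metric.closedBall 0 1) (Metric.closedBall 0 1) := by
    have h := (injective_diskExt hg hc hT).injOn.bijOn_image (s := Metric.closedBall (0 : ℂ) 1)
    rwa [image_diskExt hg hc hgs hT] at h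
  have hcont : Continuous (hbij.equiv (diskExt g)) :=
    ((continuous_diskExt hc hT).comp continuous_subtype_val).subtype_mk _
  exact ⟨hcont.homeoOfEquivCompactToT2, fun p => rfl⟩

end DiskExt

/-! ### Circular distortion and integral estimates -/

lemma arcLen_exp {a b : ℝ} (h₁ : a ≤ b) (h₂ : b < a + 2 * π) :
    arcLen (Circle.exp a) (Circle.exp b) = b - a := by
  have e : ((Circle.exp b : ℂ) / (Circle.exp a : ℂ)) = (Circle.exp (b - a) : ℂ) := by
    rw [Circle.exp_sub, Circle.coe_div]
  rw [arcLen, e]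
  rcases le_or_gt (b - a) π with h | h
  · rw [Circle.arg_exp (by linarith [Real.pi_pos]) h, if_pos (by linarith)]
  · have e' : Circle.exp (b - a) = Circle.exp (b - a - 2 * π) := (Circle.exp_sub_two_pi _).symm
    rw [e', Circle.arg_exp (by linarith) (by linarith [Real.pi_pos]), if_neg (by linarith)]
    ring

lemma rhoCirc_eq_rhoLine {h : Circle → Circle} {g : ℝ → ℝ} (hg : StrictMono g)
    (hT : ∀ x, g (x + 2 * π) = g x + 2 * π) (hh : ∀ θ : ℝ, h (Circle.exp θ) = Circle.exp (g θ))
    {θ t : ℝ} (ht₀ : 0 < t) (ht : t < 2 * π) : rhoCirc h θ t = rhoLine g θ t := by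
  have e₁ : g (θ + t) < g θ + 2 * π := by rw [← hT]; exact hg (by linarith)
  have e₂ : g θ < g (θ - t) + 2 * π := by rw [← hT]; exact hg (by linarith)
  rw [rhoCirc, rhoLine, hh, hh, hh, arcLen_exp (hg.monotone (by linarith)) e₁,
    arcLen_exp (hg.monotone (by linarith)) e₂]

lemma one_le_rhoLine {g : ℝ → ℝ} (hg : StrictMono g) {x t : ℝ} (ht : 0 < t) :
    1 ≤ rhoLine g x t := by
  have h₁ : 0 < g (x + t) - g x := sub_pos.2 (hg (by linarith))
  have h₂ : 0 < g x - g (x - t) := sub_pos.2 (hg (by linarith))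
  rcases le_total (g x - g (x - t)) (g (x + t) - g x) with h | h
  · exact le_max_of_le_left ((one_le_div h₂).2 h)
  · exact le_max_of_le_right ((one_le_div h₁).2 h)

lemma measurable_rhoLine {g : ℝ → ℝ} (hc : Continuous g) :
    Measurable fun p : ℝ × ℝ => rhoLine g p.1 p.2 := by
  have h₁ : Measurable fun p : ℝ × ℝ => g (p.1 + p.2) - g p.1 :=
    Continuous.measurable (by fun_prop)
  have h₂ : Measurable fun p : ℝ × ℝ => g p.1 - g (p.1 - p.2) :=
    Continuous.measurable (by fun_prop)
  exact (h₁.div h₂).max (h₂.div h₁)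

lemma periodic_rhoLine {g : ℝ → ℝ} {T : ℝ} (hT : ∀ x, g (x + T) = g x + T) (t : ℝ) :
    Function.Periodic (fun x => rhoLine g x t) T := fun x => by
  simp only [rhoLine, add_right_comm x T t, add_sub_right_comm x T t, hT, add_sub_add_right_eq_sub]

lemma Function.Periodic.setLIntegral_comp_add {T : ℝ} (hT : 0 < T) {f : ℝ → ENNReal}
    (hf : Function.Periodic f T) (a b s : ℝ) :
    ∫⁻ x in Ioc a (a + T), f (x + s) = ∫⁻ x in Ioc b (b + T), f x := by
  have h₁ := (measurePreserving_add_right volume s).setLIntegral_comp_preimage_emb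
    (MeasurableEquiv.addRight s).measurableEmbedding f (Ioc (a + s) (a + s + T))
  have e : (fun x => x + s) ⁻¹' Ioc (a + s) (a + s + T) = Ioc a (a + T) := by
    rw [preimage_add_const_Ioc, add_sub_cancel_right, add_right_comm, add_sub_cancel_right]
  rw [e] at h₁
  rw [h₁]
  exact IsAddFundamentalDomain.setLIntegral_eq (isAddFundamentalDomain_Ioc hT (a + s) volume)
    (isAddFundamentalDomain_Ioc hT b volume) f hf.map_vadd_zmultiples

lemma setLIntegral_reProdIm {s t : Set ℝ} {G : ℂ → ENNReal} {F : ℝ → ℝ → ENNReal}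
    (hF : Measurable (uncurry F)) (hs : MeasurableSet s) (ht : MeasurableSet t)
    (h : ∀ x ∈ s, ∀ y ∈ t, G ⟨x, y⟩ ≤ F x y) :
    ∫⁻ z in s ×ℂ t, G z ≤ ∫⁻ y in t, ∫⁻ x in s, F x y := by
  have e : s ×ℂ t = Complex.measurableEquivRealProd ⁻¹' (s ×ˢ t) := by
    ext z; simp [Complex.mem_reProdIm, Complex.measurableEquivRealProd_apply]
  calc ∫⁻ z in s ×ℂ t, G z
      ≤ ∫⁻ z in s ×ℂ t, uncurry F (Complex.measurableEquivRealProd z) := by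
        rw [e]
        refine setLIntegral_mono' (Complex.measurableEquivRealProd.measurable (hs.prod ht)) ?_
        rintro ⟨x, y⟩ hz
        exact h x hz.1 y hz.2
    _ = ∫⁻ p in s ×ˢ t, uncurry F p := by
        rw [e]
        exact Complex.volume_preserving_equiv_real_prod.setLIntegral_comp_preimage_emb
          Complex.measurableEquivRealProd.measurableEmbedding _ _
    _ = _ := by
        rw [Measure.volume_eq_prod, ← Measure.prod_restrict, lintegral_prod_symm _ hF.aemeasurable]
        rfl

/-- Outside a smaller concentric disk, the unit disk is covered by the image of a half-open
rectangle. -/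
lemma ball_subset_closedBall_union_image_exp (b : ℝ) : Metric.ball (0 : ℂ) 1 ⊆
    Metric.closedBall 0 (Real.exp (-b)) ∪
      (fun z => Complex.exp (Complex.I * z)) '' (Ioc (-π) (-π + 2 * π) ×ℂ Ioo 0 b) := by
  intro w hw
  rw [mem_ball_zero_iff] at hw
  rcases le_or_gt ‖w‖ (Real.exp (-b)) with h | h
  · exact Or.inl (mem_closedBall_zero_iff.2 h)
  · have hw₀ : w ≠ 0 := norm_pos_iff.1 ((Real.exp_pos _).trans h)
    refine Or.inr ⟨diskLift w, ⟨?_, diskLift_im_pos hw₀ hw, ?_⟩, exp_diskLift hw₀⟩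
    · have : (diskLift w).re = Complex.arg w := by simp [diskLift, Complex.log_im]
      rw [mem_preimage, this]
      exact ⟨Complex.neg_pi_lt_arg w, by linarith [Complex.arg_le_pi w]⟩
    · rw [diskLift_im, neg_lt]
      exact (Real.lt_log_iff_exp_lt (norm_pos_iff.2 hw₀)).2 h

lemma injOn_exp_I_mul (a b : ℝ) : InjOn (fun z => Complex.exp (Complex.I * z))
    (Ioc a (a + 2 * π) ×ℂ Ioo 0 b) := by
  rintro z ⟨hz, -⟩ w ⟨hw, -⟩ h
  obtain ⟨n, hn⟩ := exp_I_mul_eq_iff.1 h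
  have hre := congrArg Complex.re hn
  simp only [Complex.add_re, Complex.mul_re, Complex.intCast_re, Complex.ofReal_re,
    Complex.intCast_im, zero_mul, sub_zero] at hre
  rw [mem_preimage, mem_Ioc] at hz hw
  have h₁ : (n : ℝ) < 1 := by nlinarith [Real.pi_pos]
  have h₂ : (-1 : ℝ) < n := by nlinarith [Real.pi_pos]
  have h₀ : n = 0 := by
    have h₁' : n < 1 := by exact_mod_cast h₁
    have h₂' : -1 < n := by exact_mod_cast h₂
    omega
  rw [hn, h₀]
  simp

lemma setLIntegral_image_exp_le (a b : ℝ) (G : ℂ → ENNReal) :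
    ∫⁻ w in (fun z => Complex.exp (Complex.I * z)) '' (Ioc a (a + 2 * π) ×ℂ Ioo 0 b), G w ≤
      ∫⁻ z in Ioc a (a + 2 * π) ×ℂ Ioo 0 b, G (Complex.exp (Complex.I * z)) := by
  have hS : MeasurableSet (Ioc a (a + 2 * π) ×ℂ Ioo 0 b) :=
    (measurableSet_Ioc.preimage Complex.measurable_re).inter
      (measurableSet_Ioo.preimage Complex.measurable_im)
  have hd : ∀ z ∈ Ioc a (a + 2 * π) ×ℂ Ioo 0 b,
      HasFDerivWithinAt (fun z => Complex.exp (Complex.I * z))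
        (mulMap (Complex.exp (Complex.I * z) * Complex.I)) (Ioc a (a + 2 * π) ×ℂ Ioo 0 b) z := by
    intro z _
    refine (HasDerivAt.hasFDerivAt_mulMap ?_).hasFDerivWithinAt
    refine (((hasDerivAt_id z).const_mul Complex.I).cexp).congr_deriv ?_
    simp
  rw [lintegral_image_eq_lintegral_abs_det_fderiv_mul volume hS hd (injOn_exp_I_mul a b)]
  refine setLIntegral_mono' hS fun z hz => ?_
  refine mul_le_of_le_one_left' (ENNReal.ofReal_le_one.2 ?_)
  rw [det_mulMap, abs_of_nonneg (by positivity)]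
  refine pow_le_one₀ (norm_nonneg _) ?_
  have him : 0 < z.im := hz.2.1
  rw [norm_mul, Complex.norm_I, mul_one, Complex.norm_exp, Real.exp_le_one_iff]
  simp [him.le]

lemma setLIntegral_comp_mul_lt_top {N : ℝ → ENNReal} {b c : ℝ} (hc₀ : 0 < c) (hc₁ : c ≤ 1)
    (h : ∫⁻ y in Ioo 0 b, N y < ⊤) : ∫⁻ y in Ioo 0 b, N (c * y) < ⊤ := by
  have himg := lintegral_image_eq_lintegral_abs_deriv_mul
    (measurableSet_Ioo (a := (0 : ℝ)) (b := b))
    (f := fun y => c * y) (f' := fun _ => c)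
    (fun x _ => by simpa using ((hasDerivAt_id x).const_mul c).hasDerivWithinAt)
    (fun x _ y _ hxy => mul_left_cancel₀ hc₀.ne' hxy) N
  rw [lintegral_const_mul' _ _ ENNReal.ofReal_ne_top] at himg
  have hsub : (fun y => c * y) '' Ioo 0 b ⊆ Ioo 0 b := by
    rintro _ ⟨y, hy, rfl⟩
    exact ⟨mul_pos hc₀ hy.1, (mul_le_of_le_one_left hy.1.le hc₁).trans_lt hy.2⟩
  have hlt := (lintegral_mono_set hsub (f := N)).trans_lt h
  rw [himg] at hlt
  refine lt_of_not_ge fun htop => ?_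
  rw [top_le_iff.1 htop, ENNReal.mul_top (by simpa using hc₀.ne')] at hlt
  exact lt_irrefl _ hlt

/-- Integrability of a function periodic in its first variable is inherited by its sum over the
three points that control the dilatation. -/
lemma setLIntegral_three_points_lt_top {T b : ℝ} (hT : 0 < T) {F : ℝ → ℝ → ENNReal}
    (hF : Measurable (uncurry F)) (hper : ∀ y, Function.Periodic (fun x => F x y) T)
    (h : ∫⁻ x in Icc 0 T, ∫⁻ y in Ioo 0 b, F x y < ⊤) (a : ℝ) :
    ∫⁻ y in Ioo 0 b, ∫⁻ x in Ioc a (a + T),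
      (F x y + F (x - y / 4) (3 / 4 * y) + F (x + y / 4) (3 / 4 * y)) < ⊤ := by
  obtain ⟨N, hN⟩ : ∃ N : ℝ → ENNReal, N = fun y => ∫⁻ x in Ioc 0 (0 + T), F x y := ⟨_, rfl⟩
  have hJ : ∫⁻ y in Ioo 0 b, N y < ⊤ := by
    rw [← setLIntegral_congr Ioc_ae_eq_Icc, lintegral_lintegral_swap hF.aemeasurable] at h
    rw [hN, zero_add]
    exact h
  have hFy : ∀ y, Measurable fun x => F x y := fun y => hF.of_uncurry_right
  have hNm : Measurable N := by
    rw [hN]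
    exact hF.lintegral_prod_left
  have hinner : ∀ y, ∫⁻ x in Ioc a (a + T),
      (F x y + F (x - y / 4) (3 / 4 * y) + F (x + y / 4) (3 / 4 * y)) =
        N y + N (3 / 4 * y) + N (3 / 4 * y) := by
    intro y
    have h₀ := (hper y).setLIntegral_comp_add hT a 0 0
    have h₁ := (hper (3 / 4 * y)).setLIntegral_comp_add hT a 0 (-(y / 4))
    have h₂ := (hper (3 / 4 * y)).setLIntegral_comp_add hT a 0 (y / 4)
    simp only [add_zero, ← sub_eq_add_neg] at h₀ h₁ h₂
    rw [lintegral_add_left, lintegral_add_left (hFy y), h₀, h₁, h₂, hN]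
    exact (hFy y).add ((hFy _).comp (measurable_id.sub_const _))
  simp only [hinner]
  have h34 := setLIntegral_comp_mul_lt_top (c := 3 / 4) (by norm_num) (by norm_num) hJ
  have hm : Measurable fun y => N (3 / 4 * y) := hNm.comp (measurable_const_mul _)
  have hm' : Measurable fun y => N y + N (3 / 4 * y) := hNm.add hm
  rw [lintegral_add_left hm', lintegral_add_left hNm]
  exact ENNReal.add_lt_top.2 ⟨ENNReal.add_lt_top.2 ⟨hJ, h34⟩, h34⟩

lemma measurable_ofReal_comp_of_monotoneOn {Φ : ℝ → ℝ} (hΦ : MonotoneOn Φ (Ici 0)) :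
    Measurable fun x => ENNReal.ofReal (Φ (max x 0)) := by
  have : Monotone fun x => Φ (max x 0) := fun x y hxy =>
    hΦ (mem_Ici.2 (le_max_right _ _)) (mem_Ici.2 (le_max_right _ _)) (max_le_max_right 0 hxy)
  exact this.measurable.ennreal_ofReal

/-- A monotone function of the dilatation has finite integral over compact subdisks. -/
lemma setLIntegral_closedBall_dilC_lt_top {H : ℂ → ℂ} (hH : ContDiffOn ℝ 1 H (Metric.ball 0 1))
    (hdet : ∀ z ∈ Metric.ball (0 : ℂ) 1, 0 < (fderiv ℝ H z).det) {Φ : ℝ → ℝ}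
    (hΦ : MonotoneOn Φ (Ici 0)) {k r : ℝ} (hk : 0 ≤ k) (hr : r < 1) :
    ∫⁻ z in Metric.closedBall (0 : ℂ) r, ENNReal.ofReal (Φ (k * dilC H z)) < ⊤ := by
  have hsub : Metric.closedBall (0 : ℂ) r ⊆ Metric.ball 0 1 := Metric.closedBall_subset_ball hr
  have hd : ContinuousOn (fderiv ℝ H) (Metric.ball 0 1) :=
    hH.continuousOn_fderiv_of_isOpen Metric.isOpen_ball le_rfl
  have hcont : ContinuousOn (dilC H) (Metric.closedBall 0 r) := by
    refine ContinuousOn.mono ?_ hsub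
    exact (hd.norm.pow 2).div (ContinuousLinearMap.continuous_det.comp_continuousOn hd)
      fun z hz => (hdet z hz).ne'
  obtain ⟨B, hB⟩ := (isCompact_closedBall (0 : ℂ) r).bddAbove_image hcont
  calc _ ≤ ∫⁻ _ in Metric.closedBall (0 : ℂ) r, ENNReal.ofReal (Φ (k * max B 0)) := by
        refine setLIntegral_mono' measurableSet_closedBall fun z hz => ENNReal.ofReal_le_ofReal ?_
        have h₀ : 0 ≤ dilC H z := div_nonneg (sq_nonneg _) (hdet z (hsub hz)).le
        refine hΦ (mul_nonneg hk h₀) (mul_nonneg hk (le_max_right _ _)) ?_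
        gcongr
        exact le_max_of_le_left (hB ⟨z, hz, rfl⟩)
    _ = ENNReal.ofReal (Φ (k * max B 0)) * volume (Metric.closedBall (0 : ℂ) r) := by
        rw [setLIntegral_const]
    _ < ⊤ := ENNReal.mul_lt_top ENNReal.ofReal_lt_top measure_closedBall_lt_top

/-- There is a uniform constant `C₀ > 0` such that: if `Φ : [0,∞) → [0,∞)` is
increasing and convex, `h : S¹ → S¹` is an orientation-preserving homeomorphism, and
`∫₀^{2π} ∫₀^{π/2} Φ(q ρ_h^c(θ,t)) dt dθ < ∞` for some `q > 0`, then `h` extends to an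
orientation-preserving homeomorphism `H` of the closed unit disk, continuously differentiable
with positive Jacobian on the open disk, with `∫_𝔻 Φ(q C₀⁻¹ K_H) dx dy < ∞`. -/
theorem convex_extension_circle :
    ∃ C₀ : ℝ, 0 < C₀ ∧
      ∀ (Φ : ℝ → ℝ), ConvexOn ℝ (Ici 0) Φ → MonotoneOn Φ (Ici 0) →
        (∀ x ∈ Ici (0 : ℝ), 0 ≤ Φ x) →
      ∀ (h : Circle → Circle), IsOrientationPresHomeo h →
      ∀ q : ℝ, 0 < q →
        (∫⁻ θ in Icc (0 : ℝ) (2 * π), ∫⁻ t in Ioo (0 : ℝ) (π / 2),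
          ENNReal.ofReal (Φ (q * rhoCirc h θ t))) < ⊤ →
      ∃ H : ℂ → ℂ,
        (∃ E : Metric.closedBall (0 : ℂ) 1 ≃ₜ Metric.closedBall (0 : ℂ) 1,
          ∀ p : Metric.closedBall (0 : ℂ) 1, (E p : ℂ) = H p) ∧
        (∀ z : Circle, H z = h z) ∧
        ContDiffOn ℝ 1 H (Metric.ball (0 : ℂ) 1) ∧
        (∀ z ∈ Metric.ball (0 : ℂ) 1, 0 < (fderiv ℝ H z).det) ∧
        ∫⁻ z in Metric.ball (0 : ℂ) 1, ENNReal.ofReal (Φ (q * C₀⁻¹ * dilC H z)) < ⊤ := by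
  refine ⟨80, by norm_num, fun Φ _ hΦ _ h ⟨g, hg, hc, hgs, hT, hh⟩ q hq hint => ?_⟩
  have hdet : ∀ z ∈ Metric.ball (0 : ℂ) 1, 0 < (fderiv ℝ (diskExt g) z).det :=
    fun z hz => det_fderiv_diskExt_pos hg hc hT (mem_ball_zero_iff.1 hz)
  have hC := contDiffOn_diskExt hc hT
  refine ⟨diskExt g, exists_homeomorph_diskExt hg hc hgs hT, fun z => ?_, hC, hdet, ?_⟩
  · obtain ⟨θ, hθ⟩ := exists_circle_exp (Circle.norm_coe z)
    rw [SetLike.coe_eq_coe.1 hθ, diskExt_circle hc hT, hh]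
  obtain ⟨Ψ, hΨ⟩ : ∃ Ψ : ℝ → ENNReal, Ψ = fun x => ENNReal.ofReal (Φ (max x 0)) := ⟨_, rfl⟩
  have hΨm : Measurable Ψ := hΨ ▸ measurable_ofReal_comp_of_monotoneOn hΦ
  have hFm : Measurable (uncurry fun x y => Ψ (q * rhoLine g x y)) :=
    hΨm.comp ((measurable_rhoLine hc).const_mul q)
  have hfin : ∫⁻ x in Icc 0 (2 * π), ∫⁻ y in Ioo 0 (π / 2), Ψ (q * rhoLine g x y) < ⊤ := by
    convert hint using 3 with θ
    refine setLIntegral_congr_fun measurableSet_Ioo fun t ht => ?_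
    have hρ : 0 ≤ q * rhoLine g θ t :=
      mul_nonneg hq.le (zero_le_one.trans (one_le_rhoLine hg ht.1))
    simp only [hΨ, max_eq_left hρ]
    rw [rhoCirc_eq_rhoLine hg hT hh ht.1 (by linarith [ht.2, Real.pi_pos])]
  have h3 := setLIntegral_three_points_lt_top Real.two_pi_pos hFm
    (fun y x => by simp only [periodic_rhoLine hT y x]) hfin (-π)
  have hsmall : Real.exp (-(π / 2)) < 1 := Real.exp_lt_one_iff.2 (by linarith [Real.pi_pos])
  refine (lintegral_mono_set (ball_subset_closedBall_union_image_exp (π / 2))).trans_lt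
    ((lintegral_union_le _ _ _).trans_lt (ENNReal.add_lt_top.2
      ⟨setLIntegral_closedBall_dilC_lt_top hC hdet hΦ (by positivity) hsmall,
        (setLIntegral_image_exp_le _ _ _).trans_lt (lt_of_le_of_lt ?_ h3)⟩))
  have hm₁ : Measurable fun p : ℝ × ℝ => Ψ (q * rhoLine g (p.1 - p.2 / 4) (3 / 4 * p.2)) :=
    hFm.comp (g := uncurry fun x y => Ψ (q * rhoLine g x y))
      (f := fun p : ℝ × ℝ => (p.1 - p.2 / 4, 3 / 4 * p.2)) (by fun_prop)
  have hm₂ : Measurable fun p : ℝ × ℝ => Ψ (q * rhoLine g (p.1 + p.2 / 4) (3 / 4 * p.2)) :=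
    hFm.comp (g := uncurry fun x y => Ψ (q * rhoLine g x y))
      (f := fun p : ℝ × ℝ => (p.1 + p.2 / 4, 3 / 4 * p.2)) (by fun_prop)
  refine setLIntegral_reProdIm ((hFm.add hm₁).add hm₂) measurableSet_Ioc measurableSet_Ioo
    fun x _ y hy => ?_
  have hy₀ : 0 < y := hy.1
  have him : 0 < (⟨x, y⟩ : ℂ).im := hy₀
  have hball : Complex.exp (Complex.I * ⟨x, y⟩) ∈ Metric.ball (0 : ℂ) 1 := by
    rw [mem_ball_zero_iff, Complex.norm_exp, Real.exp_lt_one_iff]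
    simpa using hy₀
  have hnonneg : 0 ≤ dilC (diskExt g) (Complex.exp (Complex.I * ⟨x, y⟩)) :=
    div_nonneg (sq_nonneg _) (hdet _ hball).le
  have hle := dilC_diskExt_exp_le hg hc hT him
  have key : ∀ R, rhoLine g x y ≤ R → rhoLine g (x - y / 4) (3 / 4 * y) ≤ R →
      rhoLine g (x + y / 4) (3 / 4 * y) ≤ R →
      ENNReal.ofReal (Φ (q * 80⁻¹ * dilC (diskExt g) (Complex.exp (Complex.I * ⟨x, y⟩)))) ≤
        Ψ (q * R) := by
    intro R h₀ h₁ h₂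
    have hR := hle.trans (dilC_baExt_le hg hc hy₀ h₀ h₁ h₂)
    rw [hΨ]
    refine ENNReal.ofReal_le_ofReal (hΦ (mem_Ici.2 (by positivity))
      (mem_Ici.2 (le_max_right _ _)) (le_max_of_le_left ?_))
    rw [mul_assoc]
    gcongr
    linarith
  rcases le_total (rhoLine g (x - y / 4) (3 / 4 * y)) (rhoLine g x y) with h₁ | h₁
  · rcases le_total (rhoLine g (x + y / 4) (3 / 4 * y)) (rhoLine g x y) with h₂ | h₂
    · exact (key _ le_rfl h₁ h₂).trans (le_self_add.trans le_self_add)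
    · exact (key _ h₂ (h₁.trans h₂) le_rfl).trans le_add_self
  · rcases le_total (rhoLine g (x + y / 4) (3 / 4 * y)) (rhoLine g (x - y / 4) (3 / 4 * y))
      with h₂ | h₂
    · exact (key _ h₁ le_rfl h₂).trans (le_add_self.trans le_self_add)
    · exact (key _ (h₁.trans h₂) h₂ le_rfl).trans le_add_self
end
end
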